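/- arXiv:2507.20801 — 8 statements merged into one kernel-verified Lean document; each statement's English description precedes it below -/
import Mathlib

section
/- Let p ≥ 5 be a prime with p ≡ 2 (mod 3). The group GL₂(𝔽_p) acts transitively by simultaneous conjugation on pairs (U, C) where U ranges over the subgroups of GL₂(𝔽_p) of order p and C ranges over the non-split Cartan subgroups of GL₂(𝔽_p): for any subgroups U, U′ of order p and any non-split Cartan subgroups C, C′, there exists h ∈ GL₂(𝔽_p) with h·U·h⁻¹ = U′ and h·C·h⁻¹ = C′. -/
/-- The group `GL₂(𝔽_p)`, realized as the unit group of the ring of `2×2` matrices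
over `ℤ/pℤ`. -/
abbrev GL2 (p : ℕ) := (Matrix (Fin 2) (Fin 2) (ZMod p))ˣ

/-- Membership in the standard non-split Cartan subgroup `C_ε`: the matrices
`[[a, b·ε], [b, a]]` with `(a, b) ≠ (0, 0)`. -/
def memStdCartan {p : ℕ} (ε : ZMod p) (g : GL2 p) : Prop :=
  ∃ a b : ZMod p, ¬(a = 0 ∧ b = 0) ∧
    (g : Matrix (Fin 2) (Fin 2) (ZMod p)) = !![a, b * ε; b, a]

/-- A subgroup `C` of `GL₂(𝔽_p)` is a non-split Cartan subgroup if it is conjugate to the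
standard non-split Cartan subgroup `C_ε` for some quadratic non-residue `ε`. -/
def IsNonsplitCartan {p : ℕ} (C : Subgroup (GL2 p)) : Prop :=
  ∃ ε : ZMod p, ¬IsSquare ε ∧ ∃ h : GL2 p, ∀ x : GL2 p, x ∈ C ↔ memStdCartan ε (h⁻¹ * x * h)

/-- The matrix `!![0, ε; 1, 0]`, which generates the algebra spanned by the standard Cartan
subgroup `C_ε`. -/
def cartanGen {p : ℕ} (ε : ZMod p) : Matrix (Fin 2) (Fin 2) (ZMod p) := !![0, ε; 1, 0]

/-- The elementary unipotent matrix `!![1, t; 0, 1]`. -/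
def unip {p : ℕ} (t : ZMod p) : GL2 p where
  val := !![1, t; 0, 1]
  inv := !![1, -t; 0, 1]
  val_inv := by simp [Matrix.one_fin_two]
  inv_val := by simp [Matrix.one_fin_two]

theorem unip_pow {p : ℕ} (t : ZMod p) (n : ℕ) : unip t ^ n = unip ((n : ZMod p) * t) := by
  induction n with
  | zero => ext1; simp [unip, Matrix.one_fin_two]
  | succ n ih =>
    rw [pow_succ, ih]
    ext1
    simp [unip]
    ring

theorem zpowers_unip {p : ℕ} [Fact p.Prime] {t : ZMod p} (ht : t ≠ 0) :
    Subgroup.zpowers (unip t) = Subgroup.zpowers (unip 1) := by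
  have pow_val (s u : ZMod p) : unip (u * s) = unip s ^ u.val := by
    rw [unip_pow, ZMod.natCast_val, ZMod.cast_id]
  apply le_antisymm <;> rw [Subgroup.zpowers_le]
  · rw [← mul_one t, pow_val]
    exact pow_mem (Subgroup.mem_zpowers _) _
  · rw [← inv_mul_cancel₀ ht, pow_val]
    exact pow_mem (Subgroup.mem_zpowers _) _

theorem memStdCartan_iff_commute {p : ℕ} [Fact p.Prime] (ε : ZMod p) (g : GL2 p) :
    memStdCartan ε g ↔ Commute (g : Matrix (Fin 2) (Fin 2) (ZMod p)) (cartanGen ε) := by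
  constructor
  · rintro ⟨a, b, -, h⟩
    rw [h]
    simp [Commute, SemiconjBy, cartanGen, mul_comm]
  · intro h
    obtain ⟨x, y, z, w, hg⟩ : ∃ x y z w, (g : Matrix (Fin 2) (Fin 2) (ZMod p)) = !![x, y; z, w] :=
      ⟨_, _, _, _, Matrix.eta_fin_two _⟩
    have hdet := ((Matrix.isUnit_iff_isUnit_det _).mp g.isUnit).ne_zero
    rw [hg] at h hdet
    simp [Commute, SemiconjBy, cartanGen] at h
    obtain ⟨⟨h1, h2⟩, h3, h4⟩ := h
    refine ⟨x, z, ?_, ?_⟩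
    · rintro ⟨rfl, rfl⟩
      simp at hdet
    · rw [hg, h4, h3]

theorem memStdCartan_conj_iff {p : ℕ} [Fact p.Prime] {ε ε' s : ZMod p} (hs : s ≠ 0) (q x : GL2 p)
    (hq : s • ((q : Matrix (Fin 2) (Fin 2) (ZMod p)) * cartanGen ε') = cartanGen ε * q) :
    memStdCartan ε' (q⁻¹ * x * q) ↔ memStdCartan ε x := by
  rw [memStdCartan_iff_commute, memStdCartan_iff_commute]
  have hJ : cartanGen ε = s • (q * cartanGen ε' * (q⁻¹ : GL2 p)) := by
    rw [← smul_mul_assoc, hq, Units.mul_inv_cancel_right]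
  rw [hJ, Commute.smul_right_iff₀ hs]
  simp only [Commute, SemiconjBy, Units.val_mul]
  constructor <;> intro h
  · have := congrArg (fun m => (q : Matrix (Fin 2) (Fin 2) (ZMod p)) * m * (q⁻¹ : GL2 p)) h
    simpa [mul_assoc] using this
  · have := congrArg (fun m => ((q⁻¹ : GL2 p) : Matrix (Fin 2) (Fin 2) (ZMod p)) * m * q) h
    simpa [mul_assoc] using this

theorem trace_det_of_pow_prime_eq_one {p : ℕ} [Fact p.Prime] {m : Matrix (Fin 2) (Fin 2) (ZMod p)}
    (hm : m ^ p = 1) : m.trace = 2 ∧ m.det = 1 ∧ (m - 1).det = 0 := by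
  have hnil : IsNilpotent (m - 1) := ⟨p, by
    rw [sub_pow_char_of_commute (p := p) (Commute.one_right m), hm, one_pow, sub_self]⟩
  have ht := (Matrix.isNilpotent_trace_of_isNilpotent hnil).eq_zero
  have hd : (m - 1).det = 0 := by
    obtain ⟨n, hn⟩ := hnil
    have : (m - 1).det ^ n = 0 := by
      rw [← Matrix.det_pow, hn, Matrix.det_zero]
    exact (pow_eq_zero_iff (n := n) (by rintro rfl; simp at hn)).mp this
  have htr : m.trace = 2 := by
    rw [Matrix.trace_sub, Matrix.trace_one, Fintype.card_fin] at ht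
    exact_mod_cast sub_eq_zero.mp ht
  refine ⟨htr, ?_, hd⟩
  rw [Matrix.trace_fin_two] at htr
  simp [Matrix.det_fin_two] at hd ⊢
  linear_combination hd + htr

theorem exists_eq_sq_mul {p : ℕ} [Fact p.Prime] {ε ε' : ZMod p}
    (h : ¬IsSquare ε) (h' : ¬IsSquare ε') : ∃ s : ZMod p, s ≠ 0 ∧ ε = s ^ 2 * ε' := by
  have h0 : ε ≠ 0 := by rintro rfl; exact h (IsSquare.zero)
  have h0' : ε' ≠ 0 := by rintro rfl; exact h' (IsSquare.zero)
  obtain ⟨r, hr⟩ : IsSquare (ε * ε') := by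
    by_contra hc
    have e1 := quadraticChar_neg_one_iff_not_isSquare.mpr h
    have e2 := quadraticChar_neg_one_iff_not_isSquare.mpr h'
    have e3 := quadraticChar_neg_one_iff_not_isSquare.mpr hc
    rw [map_mul, e1, e2] at e3
    norm_num at e3
  have hr0 : r ≠ 0 := by
    rintro rfl
    simp_all
  refine ⟨r / ε', div_ne_zero hr0 h0', ?_⟩
  field_simp
  linear_combination hr

open Matrix in
/-- Every nontrivial element of order dividing `p` can be brought to upper unipotent form by a
matrix that also carries `C_ε` to `C_ε'`. -/
theorem exists_conj_eq_unip {p : ℕ} [Fact p.Prime] {ε ε' : ZMod p}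
    (hε : ¬IsSquare ε) (hε' : ¬IsSquare ε') {g : GL2 p} (hg : g ^ p = 1) (hg1 : g ≠ 1) :
    ∃ q : GL2 p, (∃ t ≠ 0, q⁻¹ * g * q = unip t) ∧
      ∀ x, memStdCartan ε' (q⁻¹ * x * q) ↔ memStdCartan ε x := by
  obtain ⟨htr, hdet, hker⟩ := trace_det_of_pow_prime_eq_one
    (m := (g : Matrix (Fin 2) (Fin 2) (ZMod p))) (by rw [← Units.val_pow_eq_pow_val, hg, Units.val_one])
  obtain ⟨v, hv, hgv⟩ := Matrix.exists_mulVec_eq_zero_iff.mpr hker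
  obtain ⟨s, hs, hsε⟩ := exists_eq_sq_mul hε hε'
  have hnorm : v 0 ^ 2 - ε * v 1 ^ 2 ≠ 0 := by
    intro h
    by_cases hb : v 1 = 0
    · apply hv
      ext i
      fin_cases i <;> simp_all
    · exact hε ⟨v 0 / v 1, by field_simp; linear_combination -h⟩
  have hqdet : IsUnit (!![v 0 * s, v 1 * ε; v 1 * s, v 0]).det := by
    rw [isUnit_iff_ne_zero, Matrix.det_fin_two_of]
    convert mul_ne_zero hs hnorm using 1
    ring
  obtain ⟨q, hq⟩ := (Matrix.isUnit_iff_isUnit_det _).mpr hqdet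
  refine ⟨q, ?_, fun x => memStdCartan_conj_iff hs q x ?_⟩
  · have hy1 : (q⁻¹ * g * q : GL2 p) ≠ 1 := by
      intro h
      exact hg1 ((conj_eq_one_iff (a := q⁻¹)).mp (by rwa [inv_inv]))
    have hytr : ((q⁻¹ * g * q : GL2 p) : Matrix (Fin 2) (Fin 2) (ZMod p)).trace = 2 := by
      rw [← htr, Units.val_mul, Matrix.trace_mul_comm, ← Units.val_mul]
      simp
    have hydet : ((q⁻¹ * g * q : GL2 p) : Matrix (Fin 2) (Fin 2) (ZMod p)).det = 1 := by
      rw [← hdet, Units.val_mul, Matrix.det_mul_comm, ← Units.val_mul]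
      simp
    have hqy : (q : Matrix (Fin 2) (Fin 2) (ZMod p)) * (q⁻¹ * g * q : GL2 p) = g * q := by
      simp [mul_assoc]
    have hgq : ((g : Matrix (Fin 2) (Fin 2) (ZMod p)) * (q : Matrix (Fin 2) (Fin 2) (ZMod p))) *ᵥ ![1, 0] =
        (q : Matrix (Fin 2) (Fin 2) (ZMod p)) *ᵥ ![1, 0] := by
      have : (q : Matrix (Fin 2) (Fin 2) (ZMod p)) *ᵥ ![1, 0] = s • v := by
        rw [hq]
        ext i
        fin_cases i <;> simp [mul_comm]
      rw [← Matrix.mulVec_mulVec, this, Matrix.mulVec_smul]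
      rw [Matrix.sub_mulVec, Matrix.one_mulVec, sub_eq_zero] at hgv
      rw [hgv]
    rw [← hqy, ← Matrix.mulVec_mulVec] at hgq
    have hcol := Matrix.mulVec_injective_of_isUnit q.isUnit hgq
    generalize (q⁻¹ * g * q : GL2 p) = y at *
    have h00 : (y : Matrix (Fin 2) (Fin 2) (ZMod p)) 0 0 = 1 := by simpa using congrFun hcol 0
    have h10 : (y : Matrix (Fin 2) (Fin 2) (ZMod p)) 1 0 = 0 := by simpa using congrFun hcol 1
    have h11 : (y : Matrix (Fin 2) (Fin 2) (ZMod p)) 1 1 = 1 := by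
      simpa [Matrix.det_fin_two, h00, h10] using hydet
    have hy : y = unip ((y : Matrix (Fin 2) (Fin 2) (ZMod p)) 0 1) := by
      ext i j
      fin_cases i <;> fin_cases j <;> simp [unip, *]
    refine ⟨_, ?_, hy⟩
    intro h
    rw [h] at hy
    apply hy1
    rw [hy]
    ext1
    simp [unip, Matrix.one_fin_two]
  · rw [hq, hsε]
    simp [cartanGen]
    ring_nf
    simp

theorem exists_conj_normal_form {p : ℕ} [Fact p.Prime] {ε' : ZMod p} (hε' : ¬IsSquare ε')
    {U C : Subgroup (GL2 p)} (hU : Nat.card U = p) (hC : IsNonsplitCartan C) :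
    ∃ q : GL2 p, (U.map (MulAut.conj q⁻¹).toMonoidHom = Subgroup.zpowers (unip 1)) ∧
      ∀ x, memStdCartan ε' (q⁻¹ * x * q) ↔ x ∈ C := by
  obtain ⟨ε, hε, h, hCh⟩ := hC
  have : IsCyclic U := isCyclic_of_prime_card hU
  obtain ⟨g, rfl⟩ := (Subgroup.isCyclic_iff_exists_zpowers_eq_top U).mp this
  rw [Nat.card_zpowers] at hU
  have hgp : g ^ p = 1 := orderOf_dvd_iff_pow_eq_one.mp hU.dvd
  have hg1 : g ≠ 1 := by
    rintro rfl
    exact (Fact.out : p.Prime).ne_one (hU.symm.trans orderOf_one)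
  obtain ⟨q, ⟨t, ht, hqt⟩, hq⟩ := exists_conj_eq_unip hε hε' (g := h⁻¹ * g * h)
    (by simpa [hgp] using conj_pow (i := p) (a := h⁻¹) (b := g))
    (fun e => hg1 ((conj_eq_one_iff (a := h⁻¹)).mp (by rwa [inv_inv])))
  refine ⟨h * q, ?_, fun x => ?_⟩
  · rw [MonoidHom.map_zpowers, ← zpowers_unip ht, ← hqt]
    simp [mul_assoc]
  · rw [hCh, ← hq]
    simp [mul_assoc]

/-- For a prime `p ≥ 5` with `p ≡ 2 (mod 3)`, the group `GL₂(𝔽_p)` acts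
transitively by simultaneous conjugation on pairs consisting of a subgroup of order `p`
and a non-split Cartan subgroup. -/
theorem statement3 (p : ℕ) (hp : p.Prime) (hp5 : 5 ≤ p) (hp3 : p % 3 = 2)
    (U U' C C' : Subgroup (GL2 p))
    (hU : Nat.card U = p) (hU' : Nat.card U' = p)
    (hC : IsNonsplitCartan C) (hC' : IsNonsplitCartan C') :
    ∃ h : GL2 p,
      Subgroup.map (MulAut.conj h).toMonoidHom U = U' ∧
      Subgroup.map (MulAut.conj h).toMonoidHom C = C' := by
  have := Fact.mk hp
  obtain ⟨ε, hε, -⟩ := id hC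
  obtain ⟨q, hqU, hqC⟩ := exists_conj_normal_form hε hU hC
  obtain ⟨r, hrU, hrC⟩ := exists_conj_normal_form hε hU' hC'
  refine ⟨r * q⁻¹, ?_, ?_⟩
  · have hcomp : (MulAut.conj (r * q⁻¹)).toMonoidHom =
        (MulAut.conj r).toMonoidHom.comp (MulAut.conj q⁻¹).toMonoidHom := by
      ext1 x
      simp [mul_assoc]
    have hid : (MulAut.conj r).toMonoidHom.comp (MulAut.conj r⁻¹).toMonoidHom = .id _ := by
      ext1 x
      simp [mul_assoc]
    rw [hcomp, ← Subgroup.map_map, hqU, ← hrU, Subgroup.map_map, hid, Subgroup.map_id]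
  · ext x
    rw [Subgroup.mem_map_equiv, MulAut.conj_symm_apply, ← hqC, ← hrC]
    simp [mul_assoc]
end

section
/- Let p ≥ 5 be a prime with p ≡ 2 (mod 3), let ℓ be a prime not dividing p(p²−1), let R = ℤ_(ℓ) be the localization of ℤ at the prime ideal (ℓ), and write G = GL₂(𝔽_p). Let S be a nonzero R-module, finite and free over R, equipped with a right action of G by R-linear automorphisms (equivalently, S is a right R[G]-module which is finite free over R). Suppose that for some field F of characteristic zero and some integer d ≥ 1 there is an isomorphism of right F[G]-modules S ⊗_R F ≅ (Div⁰(ℙ¹(𝔽_p); F))^{⊕d}. Then S is isomorphic to (Div⁰(ℙ¹(𝔽_p); R))^{⊕d} as a right R[G]-module. -/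
noncomputable section

/-- The projective line `ℙ¹(𝔽_p)`, as the projectivization of the plane of row vectors. -/
abbrev ProjLine (p : ℕ) [Fact p.Prime] := Projectivization (ZMod p) (Fin 2 → ZMod p)

/-- The right action of `GL₂(𝔽_p)` on `ℙ¹(𝔽_p)`: `[v]·g = [v·g]` (row vectors). -/
def p1smul {p : ℕ} [Fact p.Prime] (x : ProjLine p) (g : GL2 p) : ProjLine p :=
  Projectivization.map ((g : Matrix (Fin 2) (Fin 2) (ZMod p)).vecMulLinear)
    (by
      rw [Matrix.coe_vecMulLinear]
      exact Matrix.vecMul_injective_iff_isUnit.mpr g.isUnit) x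

/-- The degree map on the free `R`-module with basis `ℙ¹(𝔽_p)`. -/
def degMap (p : ℕ) [Fact p.Prime] (R : Type*) [CommRing R] :
    (ProjLine p →₀ R) →ₗ[R] R :=
  Finsupp.linearCombination R fun _ => (1 : R)

/-- `Div⁰(ℙ¹(𝔽_p); R)`: the kernel of the degree map. -/
def Div0 (p : ℕ) [Fact p.Prime] (R : Type*) [CommRing R] :
    Submodule R (ProjLine p →₀ R) :=
  LinearMap.ker (degMap p R)

/-- The right action of `g ∈ GL₂(𝔽_p)` on the free `R`-module with basis `ℙ¹(𝔽_p)`,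
permuting the basis elements. -/
def rAct {p : ℕ} [Fact p.Prime] (R : Type*) [CommRing R] (g : GL2 p) :
    (ProjLine p →₀ R) →ₗ[R] (ProjLine p →₀ R) :=
  Finsupp.lmapDomain R R fun x => p1smul x g

lemma rAct_mem_Div0 {p : ℕ} [Fact p.Prime] {R : Type*} [CommRing R] (g : GL2 p)
    {x : ProjLine p →₀ R} (hx : x ∈ Div0 p R) : rAct R g x ∈ Div0 p R := by
  have : degMap p R (rAct R g x) = degMap p R x := by
    simp [degMap, rAct, Finsupp.lmapDomain_apply, Finsupp.linearCombination_mapDomain]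
    rfl
  simpa [Div0, LinearMap.mem_ker, this] using hx

/-- The right action of `g ∈ GL₂(𝔽_p)` on `Div⁰(ℙ¹(𝔽_p); R)`. -/
def dAct {p : ℕ} [Fact p.Prime] (R : Type*) [CommRing R] (g : GL2 p) :
    Div0 p R →ₗ[R] Div0 p R :=
  (rAct R g).restrict fun _ hx => rAct_mem_Div0 g hx

instance spanIntPrime (ℓ : ℕ) [hl : Fact ℓ.Prime] : (Ideal.span {(ℓ : ℤ)}).IsPrime :=
  (Ideal.span_singleton_prime (by exact_mod_cast hl.out.ne_zero)).mpr
    (Nat.prime_iff_prime_int.mp hl.out)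

/-- `ℤ_(ℓ)`: the localization of `ℤ` at the prime ideal `(ℓ)`. -/
abbrev Zloc (ℓ : ℕ) [Fact ℓ.Prime] := Localization.AtPrime (Ideal.span {(ℓ : ℤ)})

section InducedLattice

variable {R G X S W : Type*} [CommRing R] [Group G] [MulAction G X]
  [AddCommGroup S] [Module R S] [AddCommGroup W] [Module R W]

/-- The submodule of vectors fixed by the stabilizer of a point `x₀`. -/
def stabFixed (ρ : G →* (S ≃ₗ[R] S)) (x₀ : X) : Submodule R S where
  carrier := {s | ∀ g ∈ MulAction.stabilizer G x₀, ρ g s = s}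
  add_mem' := fun {a b} ha hb g hg => by rw [map_add, ha g hg, hb g hg]
  zero_mem' := fun g _ => map_zero _
  smul_mem' := fun c a ha g hg => by rw [map_smul, ha g hg]

/-- The trace of a vector over the stabilizer of `x₀`, as a fixed vector. -/
def stabTrace [Fintype G] [DecidableEq X] (ρ : G →* (S ≃ₗ[R] S)) (x₀ : X) :
    S →ₗ[R] stabFixed ρ x₀ :=
  LinearMap.codRestrict _ (∑ b : MulAction.stabilizer G x₀, (ρ b : S →ₗ[R] S)) fun s g hg => by
    simp only [LinearMap.sum_apply, LinearEquiv.coe_coe, map_sum]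
    refine Fintype.sum_equiv (Equiv.mulLeft (⟨g, hg⟩ : MulAction.stabilizer G x₀)) _ _ fun b => ?_
    simp

lemma coe_stabTrace [Fintype G] [DecidableEq X] (ρ : G →* (S ≃ₗ[R] S)) (x₀ : X) (s : S) :
    (stabTrace ρ x₀ s : S) = ∑ b : MulAction.stabilizer G x₀, ρ b s := by
  change (∑ b : MulAction.stabilizer G x₀, (ρ b : S →ₗ[R] S)) s = _
  simp

variable {ρ : G →* (S ≃ₗ[R] S)} {j : S →ₗ[R] (X → W)}

lemma apply_base_stabTrace [Fintype G] [DecidableEq X]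
    (hj : ∀ g s x, j (ρ g s) (g • x) = j s x) (x₀ : X) (s : S) :
    j (stabTrace ρ x₀ s) x₀ = Fintype.card (MulAction.stabilizer G x₀) • j s x₀ := by
  rw [coe_stabTrace, map_sum, Finset.sum_apply, Finset.sum_congr rfl (g := fun _ => j s x₀),
    Finset.sum_const, Finset.card_univ]
  intro b _
  have := hj b s x₀
  rwa [MulAction.mem_stabilizer_iff.mp b.2] at this

/-- A fixed vector takes a single value off the base point, determined by its value there. -/
lemma card_sub_one_nsmul_apply_of_ne [Fintype X] [DecidableEq X]
    (h2 : ∀ x y z : X, y ≠ x → z ≠ x → ∃ g : G, g • x = x ∧ g • y = z)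
    (hj : ∀ g s x, j (ρ g s) (g • x) = j s x) (h0 : ∀ s, ∑ x, j s x = 0)
    {x₀ : X} (m : stabFixed ρ x₀) {y : X} (hy : y ≠ x₀) :
    (Fintype.card X - 1) • j m y = - j m x₀ := by
  have hc : ∀ z ∈ Finset.univ.erase x₀, j m z = j m y := by
    intro z hz
    obtain ⟨g, hg, rfl⟩ := h2 x₀ y z hy (Finset.ne_of_mem_erase hz)
    have := hj g m y
    rwa [m.2 g hg] at this
  have := h0 m
  rw [← Finset.add_sum_erase _ _ (Finset.mem_univ x₀), Finset.sum_congr rfl hc, Finset.sum_const,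
    Finset.card_erase_of_mem (Finset.mem_univ _), Finset.card_univ] at this
  exact eq_neg_of_add_eq_zero_right this

lemma eq_of_apply_base_eq [Fintype X] [DecidableEq X] [IsAddTorsionFree W]
    (hX : 2 ≤ Fintype.card X)
    (h2 : ∀ x y z : X, y ≠ x → z ≠ x → ∃ g : G, g • x = x ∧ g • y = z)
    (hj : ∀ g s x, j (ρ g s) (g • x) = j s x) (h0 : ∀ s, ∑ x, j s x = 0)
    (hinj : Function.Injective j) {x₀ : X} {m m' : stabFixed ρ x₀} (h : j m x₀ = j m' x₀) :
    m = m' := by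
  refine Subtype.ext (hinj (funext fun y => ?_))
  by_cases hy : y = x₀
  · rw [hy, h]
  · have hn : Fintype.card X - 1 ≠ 0 := by omega
    apply nsmul_right_injective hn
    simp only
    rw [card_sub_one_nsmul_apply_of_ne h2 hj h0 m hy,
      card_sub_one_nsmul_apply_of_ne h2 hj h0 m' hy, h]

/-- A lattice which embeds equivariantly into a space of functions of sum zero on a
`2`-transitive set `X` is isomorphic to the functions of sum zero on `X` with values in its
vectors fixed by a point stabilizer, as soon as the relevant integers are invertible. -/
theorem exists_linearMap_stabFixed [Fintype G] [Fintype X] [DecidableEq X] [IsAddTorsionFree W]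
    (hX : 2 ≤ Fintype.card X)
    (h1 : ∀ x y : X, ∃ g : G, g • x = y)
    (h2 : ∀ x y z : X, y ≠ x → z ≠ x → ∃ g : G, g • x = x ∧ g • y = z)
    (hG : IsUnit (Fintype.card G : R)) (hXu : IsUnit (Fintype.card X : R))
    (hj : ∀ g s x, j (ρ g s) (g • x) = j s x) (h0 : ∀ s, ∑ x, j s x = 0)
    (hinj : Function.Injective j) (x₀ : X) :
    ∃ Ψ : S →ₗ[R] (X → stabFixed ρ x₀), Function.Injective Ψ ∧
      (∀ f, f ∈ LinearMap.range Ψ ↔ ∑ x, f x = 0) ∧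
      ∀ g s x, Ψ (ρ g s) (g • x) = Ψ s x := by
  choose γ hγ using h1 x₀
  set N := Fintype.card (MulAction.stabilizer G x₀) with hN
  have hNu : IsUnit (N : R) := by
    have hd : N ∣ Fintype.card G := by
      simpa [hN, Nat.card_eq_fintype_card] using
        Subgroup.card_subgroup_dvd_card (MulAction.stabilizer G x₀)
    exact isUnit_of_dvd_unit (Nat.cast_dvd_cast hd) hG
  have hN0 : N ≠ 0 := Fintype.card_ne_zero
  let Ψ : S →ₗ[R] (X → stabFixed ρ x₀) :=
    LinearMap.pi fun x => stabTrace ρ x₀ ∘ₗ (ρ (γ x)⁻¹ : S →ₗ[R] S)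
  have hΨ : ∀ s x, j (Ψ s x) x₀ = N • j s x := by
    intro s x
    have h : j (ρ (γ x)⁻¹ s) x₀ = j s x := by
      rw [← hj (γ x)⁻¹ s x, inv_smul_eq_iff.mpr (hγ x).symm]
    simp only [Ψ, LinearMap.pi_apply, LinearMap.comp_apply, LinearEquiv.coe_coe]
    rw [apply_base_stabTrace hj, h]
  refine ⟨Ψ, ?_, ?_, ?_⟩
  · intro s t hst
    refine hinj (funext fun x => nsmul_right_injective hN0 ?_)
    simp only
    rw [← hΨ, ← hΨ, hst]
  · intro f
    constructor
    · rintro ⟨s, rfl⟩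
      refine eq_of_apply_base_eq hX h2 hj h0 hinj ?_
      simp only [AddSubmonoidClass.coe_finsetSum, map_sum, Finset.sum_apply, hΨ]
      rw [← Finset.smul_sum, h0]
      simp
    · intro hf
      obtain ⟨u, hu⟩ := hNu.mul hXu
      have hΦ : ∀ y, (Fintype.card X - 1) • j (∑ x, ρ (γ x) (f x)) y =
          Fintype.card X • j (f y) x₀ := by
        intro y
        have key : ∀ x, (Fintype.card X - 1) • j (ρ (γ x) (f x)) y =
            (if x = y then Fintype.card X • j (f y) x₀ else 0) - j (f x) x₀ := by
          intro x
          have e1 : j (ρ (γ x) (f x)) y = j (f x) ((γ x)⁻¹ • y) := by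
            rw [← hj (γ x) (f x) ((γ x)⁻¹ • y), smul_inv_smul]
          rw [e1]
          split_ifs with h
          · subst h
            have : (γ x)⁻¹ • x = x₀ := by rw [inv_smul_eq_iff, hγ]
            rw [this]
            nth_rewrite 2 [show Fintype.card X = Fintype.card X - 1 + 1 by omega]
            rw [succ_nsmul, add_sub_cancel_right]
          · rw [card_sub_one_nsmul_apply_of_ne h2 hj h0, zero_sub]
            rw [Ne, inv_smul_eq_iff, hγ]
            exact fun h' => h h'.symm
        have hz : ∑ x, j (f x) x₀ = 0 := by
          have := congrArg (fun m : stabFixed ρ x₀ => j m x₀) hf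
          simpa using this
        rw [map_sum, Finset.sum_apply, Finset.smul_sum, Finset.sum_congr rfl fun x _ => key x,
          Finset.sum_sub_distrib, hz]
        simp
      have hfin : Ψ ((Fintype.card X - 1) • ∑ x, ρ (γ x) (f x)) = (N * Fintype.card X) • f := by
        funext y
        refine eq_of_apply_base_eq hX h2 hj h0 hinj ?_
        rw [hΨ, map_nsmul, Pi.smul_apply, hΦ]
        simp [mul_smul]
      refine ⟨(↑u⁻¹ : R) • ((Fintype.card X - 1) • ∑ x, ρ (γ x) (f x)), ?_⟩
      rw [map_smul, hfin, ← Nat.cast_smul_eq_nsmul R, Nat.cast_mul, ← hu, smul_smul,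
        Units.inv_mul, one_smul]
  · intro g s x
    refine eq_of_apply_base_eq hX h2 hj h0 hinj ?_
    rw [hΨ, hΨ, hj]

end InducedLattice

/-- Rank-nullity for a surjective map of finite modules. -/
lemma finrank_ker_add_of_surjective {R V V' : Type*} [CommRing R] [IsDomain R]
    [AddCommGroup V] [Module R V] [Module.Finite R V] [AddCommGroup V'] [Module R V']
    {φ : V →ₗ[R] V'} (hφ : Function.Surjective φ) :
    Module.finrank R (LinearMap.ker φ) + Module.finrank R V' = Module.finrank R V := by
  rw [← Submodule.finrank_quotient_add_finrank (LinearMap.ker φ),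
    (φ.quotKerEquivOfSurjective hφ).finrank_eq, add_comm]

section ProjectiveLine

variable {p : ℕ} [Fact p.Prime]

/-- The right action on the projective line, as a left action of the opposite group. -/
abbrev p1MulAction (p : ℕ) [Fact p.Prime] : MulAction (GL2 p)ᵐᵒᵖ (ProjLine p) where
  smul g x := p1smul x g.unop
  one_smul x := by
    change p1smul x 1 = x
    induction x using Projectivization.ind with
    | h v hv => simp [p1smul, Projectivization.map_mk]
  mul_smul g h x := by
    change p1smul x (h.unop * g.unop) = p1smul (p1smul x h.unop) g.unop
    induction x using Projectivization.ind with
    | h v hv => simp [p1smul, Projectivization.map_mk, Matrix.vecMul_vecMul]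

lemma exists_p1smul_eq_of_ne {x y x' y' : ProjLine p} (h : x ≠ y) (h' : x' ≠ y') :
    ∃ g : GL2 p, p1smul x g = x' ∧ p1smul y g = y' := by
  obtain ⟨f, hf⟩ := MulAction.is_two_pretransitive_iff.mp
    (Projectivization.linearEquiv_is_two_pretransitive (ZMod p) (Fin 2 → ZMod p)) h h'
  have hu : IsUnit (LinearMap.toMatrix'
      (f : (Fin 2 → ZMod p) →ₗ[ZMod p] (Fin 2 → ZMod p))).transpose := by
    rw [Matrix.isUnit_transpose]
    exact LinearMap.isUnit_toMatrix'_iff.mpr ((LinearMap.isUnit_iff_ker_eq_bot _).mpr f.ker)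
  have key : ∀ z : ProjLine p, p1smul z hu.unit = f • z := by
    intro z
    induction z using Projectivization.ind with
    | h v hv =>
      simp [p1smul, Projectivization.map_mk, Projectivization.smul_mk,
        LinearMap.toMatrix'_mulVec]
  exact ⟨hu.unit, by rw [key, hf.1], by rw [key, hf.2]⟩

lemma card_projLine : Nat.card (ProjLine p) = p + 1 := by
  rw [Projectivization.card_of_finrank_two _ _ (by simp)]
  simp

lemma card_GL2 : Nat.card (GL2 p) = (p ^ 2 - 1) * (p ^ 2 - p) := by
  have := Matrix.card_GL_field (𝔽 := ZMod p) 2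
  simpa [Fin.prod_univ_two] using this

lemma rAct_apply_p1smul (R : Type*) [CommRing R] (g : GL2 p) (f : ProjLine p →₀ R)
    (x : ProjLine p) : rAct R g f (p1smul x g) = f x :=
  Finsupp.mapDomain_apply (Projectivization.map_injective _ _) f x

lemma degMap_apply [Fintype (ProjLine p)] (R : Type*) [CommRing R] (f : ProjLine p →₀ R) :
    degMap p R f = ∑ x, f x := by
  simp [degMap, Finsupp.linearCombination_apply, Finsupp.sum_fintype]

lemma finrank_Div0 (F : Type*) [Field F] : Module.finrank F (Div0 p F) = p := by
  have := Fintype.ofFinite (ProjLine p)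
  have hs : Function.Surjective (degMap p F) := by
    intro a
    obtain ⟨x⟩ : Nonempty (ProjLine p) := inferInstance
    exact ⟨Finsupp.single x a, by simp [degMap]⟩
  have h := finrank_ker_add_of_surjective hs
  rw [Module.finrank_self, Module.finrank_finsupp_self, ← Nat.card_eq_fintype_card,
    card_projLine] at h
  exact Nat.add_right_cancel h

end ProjectiveLine

lemma isUnit_natCast_Zloc {ℓ : ℕ} [Fact ℓ.Prime] {n : ℕ} (h : ¬ ℓ ∣ n) :
    IsUnit (n : Zloc ℓ) := by
  have := (IsLocalization.AtPrime.isUnit_to_map_iff (Zloc ℓ) (Ideal.span {(ℓ : ℤ)}) (n : ℤ)).mpr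
    (by
      rw [Ideal.mem_primeCompl_iff, Ideal.mem_span_singleton]
      exact_mod_cast h)
  simpa using this

lemma faithfulSMul_Zloc (ℓ : ℕ) [Fact ℓ.Prime] (F : Type*) [Field F] [CharZero F]
    [Algebra (Zloc ℓ) F] : FaithfulSMul (Zloc ℓ) F := by
  rw [faithfulSMul_iff_algebraMap_injective, injective_iff_map_eq_zero]
  intro a ha
  obtain ⟨⟨n, s⟩, hn⟩ := IsLocalization.surj (Ideal.span {(ℓ : ℤ)}).primeCompl a
  have hn' := congrArg (algebraMap (Zloc ℓ) F) hn
  rw [map_mul, ha, zero_mul, eq_comm] at hn'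
  have : n = 0 := by simpa using hn'
  rw [this, map_zero] at hn
  exact ((IsLocalization.map_units (Zloc ℓ) s).mul_left_eq_zero).mp hn

/-- Let `p ≥ 5` with `p ≡ 2 (mod 3)` and `ℓ ∤ p(p²−1)` be primes, and
`R = ℤ_(ℓ)`. Let `S` be a nonzero finite free `R`-module with a right action of
`G = GL₂(𝔽_p)` by `R`-linear automorphisms (a morphism from `Gᵐᵒᵖ`). If for some field `F`
of characteristic zero the base change `S ⊗_R F` is isomorphic to `Div⁰(ℙ¹(𝔽_p); F)^{⊕d}`
as a right `F[G]`-module, then `S ≅ Div⁰(ℙ¹(𝔽_p); R)^{⊕d}` as right `R[G]`-modules. -/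
theorem statement4 (p : ℕ) (hp : p.Prime) [Fact p.Prime] (hp5 : 5 ≤ p) (hp3 : p % 3 = 2)
    (ℓ : ℕ) (hℓ : ℓ.Prime) [Fact ℓ.Prime] (hℓp : ¬ℓ ∣ p * (p ^ 2 - 1))
    (S : Type*) [AddCommGroup S] [Module (Zloc ℓ) S] [Nontrivial S]
    [Module.Finite (Zloc ℓ) S] [Module.Free (Zloc ℓ) S]
    (ρ : (GL2 p)ᵐᵒᵖ →* (S ≃ₗ[Zloc ℓ] S))
    (F : Type*) [Field F] [CharZero F] [Algebra (Zloc ℓ) F]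
    (d : ℕ) (hd : 1 ≤ d)
    (e : TensorProduct (Zloc ℓ) F S ≃ₗ[F] (Fin d → Div0 p F))
    (he : ∀ (g : GL2 p) (x : TensorProduct (Zloc ℓ) F S),
      e ((ρ (MulOpposite.op g)).toLinearMap.baseChange F x) =
        fun i => dAct F g (e x i)) :
    ∃ e' : S ≃ₗ[Zloc ℓ] (Fin d → Div0 p (Zloc ℓ)),
      ∀ (g : GL2 p) (x : S),
        e' (ρ (MulOpposite.op g) x) = fun i => dAct (Zloc ℓ) g (e' x i) := by
  classical
  let := p1MulAction p
  have hop : ∀ (g : (GL2 p)ᵐᵒᵖ) (x : ProjLine p), g • x = p1smul x g.unop := fun _ _ => rfl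
  let := Fintype.ofFinite (ProjLine p)
  let : Fintype (GL2 p)ᵐᵒᵖ := Fintype.ofEquiv (GL2 p) MulOpposite.opEquiv
  have := faithfulSMul_Zloc ℓ F
  have hcX : Fintype.card (ProjLine p) = p + 1 := by
    rw [← Nat.card_eq_fintype_card, card_projLine]
  have hfac : p ^ 2 - 1 = (p + 1) * (p - 1) := by simpa using Nat.sq_sub_sq p 1
  have hℓ1 : ¬ ℓ ∣ p ^ 2 - 1 := fun h => hℓp (h.mul_left p)
  have hXu : IsUnit (Fintype.card (ProjLine p) : Zloc ℓ) := by
    rw [hcX]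
    exact isUnit_natCast_Zloc fun h => hℓ1 (hfac ▸ h.mul_right _)
  have hGu : IsUnit (Fintype.card (GL2 p)ᵐᵒᵖ : Zloc ℓ) := by
    rw [← Nat.card_eq_fintype_card, Nat.card_congr MulOpposite.opEquiv.symm, card_GL2]
    refine isUnit_natCast_Zloc fun h => ?_
    rcases hℓ.dvd_mul.mp h with h | h
    · exact hℓ1 h
    · rw [show p ^ 2 - p = p * (p - 1) by rw [Nat.mul_sub_one, sq]] at h
      rcases hℓ.dvd_mul.mp h with h | h
      · exact hℓp (h.mul_right _)
      · exact hℓ1 (hfac ▸ h.mul_left _)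
  have h2t : ∀ x y x' y' : ProjLine p, x ≠ y → x' ≠ y' →
      ∃ g : (GL2 p)ᵐᵒᵖ, g • x = x' ∧ g • y = y' := by
    intro x y x' y' h h'
    obtain ⟨g, hg⟩ := exists_p1smul_eq_of_ne h h'
    exact ⟨MulOpposite.op g, hg⟩
  have : Nontrivial (ProjLine p) := by
    rw [← Fintype.one_lt_card_iff_nontrivial, hcX]
    omega
  have h1 : ∀ x y : ProjLine p, ∃ g : (GL2 p)ᵐᵒᵖ, g • x = y := by
    intro x y
    obtain ⟨x', hx'⟩ := exists_ne x
    obtain ⟨y', hy'⟩ := exists_ne y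
    obtain ⟨g, hg, -⟩ := h2t x x' y y' hx'.symm hy'.symm
    exact ⟨g, hg⟩
  have h2 : ∀ x y z : ProjLine p, y ≠ x → z ≠ x →
      ∃ g : (GL2 p)ᵐᵒᵖ, g • x = x ∧ g • y = z :=
    fun x y z hy hz => h2t x y x z hy.symm hz.symm
  let j : S →ₗ[Zloc ℓ] (ProjLine p → (Fin d → F)) :=
    { toFun := fun s x i => (e (1 ⊗ₜ s) i : ProjLine p →₀ F) x
      map_add' := fun s t => by
        funext x i
        simp [TensorProduct.tmul_add]
      map_smul' := fun r s => by
        funext x i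
        rw [TensorProduct.tmul_smul, ← algebraMap_smul F r, map_smul]
        simp [Algebra.smul_def] }
  have hj_apply : ∀ s x i, j s x i = (e (1 ⊗ₜ s) i : ProjLine p →₀ F) x := fun _ _ _ => rfl
  have hj : ∀ g s x, j (ρ g s) (g • x) = j s x := by
    intro g s x
    funext i
    have h := he g.unop (1 ⊗ₜ s)
    rw [LinearMap.baseChange_tmul] at h
    rw [hj_apply, hj_apply, hop]
    refine (congrArg (fun f : Div0 p F => (f : ProjLine p →₀ F) (p1smul x g.unop))
      (congrFun h i)).trans ?_
    exact rAct_apply_p1smul F g.unop _ x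
  have h0 : ∀ s, ∑ x, j s x = 0 := by
    intro s
    funext i
    rw [Finset.sum_apply]
    simp only [hj_apply]
    rw [← degMap_apply]
    exact (e (1 ⊗ₜ s) i).2
  have hinj : Function.Injective j := by
    intro s t hst
    refine Module.Flat.tensorProduct_mk_injective (Zloc ℓ) S F (e.injective ?_)
    funext i
    refine Subtype.ext (Finsupp.ext fun x => ?_)
    exact congrFun (congrFun hst x) i
  obtain ⟨x₀⟩ : Nonempty (ProjLine p) := inferInstance
  obtain ⟨Ψ, hΨinj, hΨrange, hΨ⟩ := exists_linearMap_stabFixed (by omega) h1 h2 hGu hXu hj h0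
    hinj x₀
  have hrank : Module.finrank (Zloc ℓ) (stabFixed ρ x₀) = d := by
    let σ : (ProjLine p → stabFixed ρ x₀) →ₗ[Zloc ℓ] stabFixed ρ x₀ :=
      ∑ x, LinearMap.proj x
    have hσ : ∀ f, σ f = ∑ x, f x := fun f => by simp [σ]
    have hσs : Function.Surjective σ := fun m => ⟨Pi.single x₀ m, by simp [hσ]⟩
    have hker : LinearMap.range Ψ = LinearMap.ker σ := by
      ext f
      rw [hΨrange, LinearMap.mem_ker, hσ]
    have hr := finrank_ker_add_of_surjective hσs
    have hS : Module.finrank (Zloc ℓ) S = d * p := by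
      have : Module.Free F (Div0 p F) := Module.Free.of_divisionRing F (Div0 p F)
      rw [← Module.finrank_baseChange (R := F), e.finrank_eq, Module.finrank_pi_fintype]
      simp [finrank_Div0]
    rw [← hker, LinearMap.finrank_range_of_inj hΨinj, hS, Module.finrank_pi_fintype] at hr
    simp only [Finset.sum_const, Finset.card_univ, hcX, smul_eq_mul] at hr
    exact Nat.eq_of_mul_eq_mul_left hp.pos (by linarith)
  let b : stabFixed ρ x₀ ≃ₗ[Zloc ℓ] (Fin d → Zloc ℓ) :=
    (Module.finBasisOfFinrankEq (Zloc ℓ) (stabFixed ρ x₀) hrank).equivFun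
  let θ : S →ₗ[Zloc ℓ] (Fin d → Div0 p (Zloc ℓ)) :=
    { toFun := fun s i => ⟨Finsupp.equivFunOnFinite.symm fun x => b (Ψ s x) i, by
        have h := congrFun (congrArg b ((hΨrange (Ψ s)).mp ⟨s, rfl⟩)) i
        rw [Div0, LinearMap.mem_ker, degMap_apply]
        simpa using h⟩
      map_add' := fun s t => by
        funext i
        ext x
        simp
      map_smul' := fun r s => by
        funext i
        ext x
        simp }
  have hθ : ∀ s i x, (θ s i : ProjLine p →₀ Zloc ℓ) x = b (Ψ s x) i := fun _ _ _ => rfl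
  have hθbij : Function.Bijective θ := by
    constructor
    · intro s t hst
      refine hΨinj (funext fun x => b.injective (funext fun i => ?_))
      rw [← hθ, ← hθ, hst]
    · intro f
      obtain ⟨s, hs⟩ := (hΨrange fun x => b.symm fun i => (f i : ProjLine p →₀ Zloc ℓ) x).mpr (by
        rw [← map_sum, LinearEquiv.map_eq_zero_iff]
        funext i
        rw [Finset.sum_apply, ← degMap_apply]
        exact (f i).2)
      refine ⟨s, funext fun i => Subtype.ext (Finsupp.ext fun x => ?_)⟩
      rw [hθ, hs, LinearEquiv.apply_symm_apply]
  refine ⟨LinearEquiv.ofBijective θ hθbij, fun g s => funext fun i =>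
    Subtype.ext (Finsupp.ext fun x => ?_)⟩
  obtain ⟨y, rfl⟩ : ∃ y, p1smul y g = x :=
    ⟨(MulOpposite.op g)⁻¹ • x, smul_inv_smul (MulOpposite.op g) x⟩
  rw [LinearEquiv.ofBijective_apply, LinearEquiv.ofBijective_apply, hθ]
  refine (congrArg (fun m => b m i) (hΨ (MulOpposite.op g) s y)).trans ?_
  exact (rAct_apply_p1smul (Zloc ℓ) g (θ s i) y).symm

end
end

section
/- Let q be a prime, ℤ_q the ring of q-adic integers, A a commutative ℤ_q-algebra which is finite and free as a ℤ_q-module, and M a finitely generated A-module. Make the Pontryagin dual M^∨ := Hom_{ℤ_q}(M, ℚ_q/ℤ_q) into an A-module by (a·f)(m) := f(a·m). Then for every maximal ideal 𝔮 of A, the localization M_𝔮 of M at 𝔮 is a finite set if and only if the localization (M^∨)_𝔮 of M^∨ at 𝔮 is a finite set. -/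
noncomputable section

/-- `ℤ_q`, viewed as a `ℤ_q`-submodule of `ℚ_q` (the image of the canonical inclusion). -/
def padicIntSubmodule (q : ℕ) [Fact q.Prime] : Submodule ℤ_[q] ℚ_[q] :=
  LinearMap.range (Algebra.linearMap ℤ_[q] ℚ_[q])

/-- The `ℤ_q`-module `ℚ_q/ℤ_q`. -/
abbrev QmodZ (q : ℕ) [Fact q.Prime] := ℚ_[q] ⧸ padicIntSubmodule q

variable {q : ℕ} [Fact q.Prime] {A : Type*} [CommRing A] [Algebra ℤ_[q] A]
  {M : Type*} [AddCommGroup M] [Module A M] [Module ℤ_[q] M] [IsScalarTower ℤ_[q] A M]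

/-- Multiplication by `a : A` on `M`, as a `ℤ_q`-linear map. -/
def smulLin (a : A) : M →ₗ[ℤ_[q]] M where
  toFun m := a • m
  map_add' := smul_add a
  map_smul' c m := (smul_comm c a m).symm

/-- The Pontryagin dual `M^∨ = Hom_{ℤ_q}(M, ℚ_q/ℤ_q)` as an `A`-module, with the action
`(a • f) m = f (a • m)`. -/
instance dualModule : Module A (M →ₗ[ℤ_[q]] QmodZ q) where
  smul a f := f ∘ₗ smulLin a
  one_smul f := LinearMap.ext fun m => by
    show f ((1 : A) • m) = f m
    rw [one_smul]
  mul_smul a b f := LinearMap.ext fun m => by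
    show f ((a * b) • m) = f (b • a • m)
    rw [← smul_smul, smul_comm]
  smul_zero a := LinearMap.ext fun m => rfl
  smul_add a f g := LinearMap.ext fun m => rfl
  add_smul a b f := LinearMap.ext fun m => by
    show f ((a + b) • m) = f (a • m) + f (b • m)
    rw [add_smul, map_add]
  zero_smul f := LinearMap.ext fun m => by
    show f ((0 : A) • m) = 0
    rw [zero_smul, map_zero]

section Localization

variable {R N : Type*} [CommRing R] [AddCommGroup N] [Module R N]

/-- If some element of `S` has finite image on `N`, then `S⁻¹N` is finite. -/
theorem finite_localizedModule_of_finite_range_smul (S : Submonoid R) {s : R} (hs : s ∈ S)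
    (h : (Set.range fun x : N => s • x).Finite) : Finite (LocalizedModule S N) := by
  have hfin : Finite (LinearMap.range (LinearMap.lsmul R N s)) := h
  refine Finite.of_surjective
    (fun x : LinearMap.range (LinearMap.lsmul R N s) => LocalizedModule.mk (x : N) (⟨s, hs⟩ : S)) ?_
  intro y
  induction y using LocalizedModule.induction_on with
  | h m t =>
  obtain ⟨a, b, hab, he⟩ := Finite.exists_ne_map_eq_of_infinite
    (fun k : ℕ => (fun x : LinearMap.range (LinearMap.lsmul R N s) => (t : R) ^ k • x))
  wlog hlt : a < b generalizing a b
  · exact this b a hab.symm he.symm (lt_of_le_of_ne (not_lt.mp hlt) hab.symm)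
  obtain ⟨c, rfl⟩ := Nat.exists_eq_add_of_lt hlt
  refine ⟨⟨s • (t : R) ^ c • m, ⟨(t : R) ^ c • m, rfl⟩⟩, ?_⟩
  rw [LocalizedModule.mk_eq]
  refine ⟨t ^ a, ?_⟩
  have := congrArg Subtype.val (congrFun he ⟨s • m, ⟨m, rfl⟩⟩)
  simp only [Submonoid.smul_def, SubmonoidClass.coe_pow, Submodule.coe_smul] at this ⊢
  rw [this]
  simp only [smul_smul]
  congr 1
  ring

theorem exists_smul_eq_zero_of_mk_eq_zero [Module.Finite R N] (S : Submonoid R) (a : R)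
    (h : ∀ x : N, LocalizedModule.mk (a • x) (1 : S) = 0) :
    ∃ s ∈ S, ∀ x : N, s • a • x = 0 := by
  obtain ⟨k, g, hg⟩ := Module.Finite.exists_fin (R := R) (M := N)
  have h' : ∀ x : N, ∃ u : S, (u : R) • a • x = 0 := by
    intro x
    have := h x
    rw [← LocalizedModule.zero_mk (1 : S), LocalizedModule.mk_eq] at this
    obtain ⟨u, hu⟩ := this
    exact ⟨u, by simpa [Submonoid.smul_def] using hu⟩
  choose u hu using h'
  refine ⟨((∏ i, u (g i) : S) : R), (∏ i, u (g i)).2, fun x => ?_⟩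
  have hx : x ∈ Submodule.span R (Set.range g) := hg ▸ Submodule.mem_top
  induction hx using Submodule.span_induction with
  | mem x hx =>
    obtain ⟨i, rfl⟩ := hx
    rw [← Finset.prod_erase_mul _ _ (Finset.mem_univ i), Submonoid.coe_mul, mul_smul, hu, smul_zero]
  | zero => simp
  | add x y _ _ hx hy => rw [smul_add, smul_add, hx, hy, add_zero]
  | smul c x _ hx => rw [smul_comm a c, smul_comm _ c, hx, smul_zero]

end Localization

section Padic

variable (q)

theorem finite_of_pow_smul_eq_zero {N : Type*} [AddCommGroup N] [Module ℤ_[q] N]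
    [Module.Finite ℤ_[q] N] (n : ℕ) (h : ∀ x : N, (q : ℤ_[q]) ^ n • x = 0) : Finite N := by
  let I : Ideal ℤ_[q] := Ideal.span {(q : ℤ_[q]) ^ n}
  have : NeZero (q ^ n) := ⟨pow_ne_zero _ (Fact.out : q.Prime).ne_zero⟩
  have hq : Finite (ℤ_[q] ⧸ I) := by
    have hk := PadicInt.ker_toZModPow (p := q) n
    refine Finite.of_injective _ ((Ideal.quotEquivOfEq hk.symm).trans
      (RingHom.quotientKerEquivRange (PadicInt.toZModPow n))).injective
  have hN : Module.IsTorsionBySet ℤ_[q] N I := by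
    rw [Module.isTorsionBySet_span_singleton_iff]
    exact fun x => h x
  let _ := hN.module
  have : IsScalarTower ℤ_[q] (ℤ_[q] ⧸ I) N := hN.isScalarTower
  have : Module.Finite (ℤ_[q] ⧸ I) N := Module.Finite.of_restrictScalars_finite ℤ_[q] _ _
  exact Module.finite_of_finite (ℤ_[q] ⧸ I)

theorem exists_natCast_pow_smul_eq_zero {A P : Type*} [CommRing A] [Algebra ℤ_[q] A]
    [AddCommGroup P] [Module A P] [Finite P] : ∃ n : ℕ, ∀ x : P, (q : A) ^ n • x = 0 := by
  have hc : Nat.card P ≠ 0 := Nat.card_pos.ne'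
  obtain ⟨n, u, hu, hcu⟩ := Nat.exists_eq_pow_mul_and_not_dvd hc q (Fact.out : q.Prime).ne_one
  refine ⟨n, fun x => ?_⟩
  have hunit : IsUnit (u : A) := by
    have : IsUnit (u : ℤ_[q]) := by
      rw [PadicInt.isUnit_iff]
      exact_mod_cast (PadicInt.norm_natCast_eq_one_iff (p := q)).2
        ((Nat.Prime.coprime_iff_not_dvd Fact.out).2 hu)
    simpa using this.map (algebraMap ℤ_[q] A)
  rw [← hunit.smul_eq_zero, smul_smul]
  have : Nat.card P • x = 0 := card_nsmul_eq_zero'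
  rw [hcu, ← Nat.cast_smul_eq_nsmul A] at this
  rw [mul_comm]
  exact_mod_cast this

theorem exists_smul_pow_smul_eq_zero_of_finite {A N : Type*} [CommRing A] [Algebra ℤ_[q] A]
    [AddCommGroup N] [Module A N] [Module.Finite A N] (S : Submonoid A)
    [Finite (LocalizedModule S N)] :
    ∃ s ∈ S, ∃ n : ℕ, ∀ m : N, s • (q : A) ^ n • m = 0 := by
  obtain ⟨n, hn⟩ := exists_natCast_pow_smul_eq_zero q (A := A) (P := LocalizedModule S N)
  obtain ⟨s, hs, h⟩ := exists_smul_eq_zero_of_mk_eq_zero S ((q : A) ^ n) (N := N) fun x => by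
    rw [← LocalizedModule.smul'_mk, hn]
  exact ⟨s, hs, n, h⟩

theorem natCast_prime_mem_of_isMaximal {A : Type*} [CommRing A] [Algebra ℤ_[q] A]
    [Module.Finite ℤ_[q] A] (𝔮 : Ideal A) [𝔮.IsMaximal] : (q : A) ∈ 𝔮 := by
  have h := Ideal.isMaximal_comap_of_isIntegral_of_isMaximal (R := ℤ_[q]) 𝔮
  have h2 := IsLocalRing.eq_maximalIdeal h
  have h3 : (q : ℤ_[q]) ∈ 𝔮.comap (algebraMap ℤ_[q] A) := by
    rw [h2, PadicInt.maximalIdeal_eq_span_p]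
    exact Ideal.mem_span_singleton_self _
  simpa using h3

theorem QmodZ_exists_smul_eq {c : ℤ_[q]} (hc : c ≠ 0) (x : QmodZ q) : ∃ y : QmodZ q, c • y = x := by
  obtain ⟨x, rfl⟩ := Submodule.Quotient.mk_surjective _ x
  refine ⟨Submodule.Quotient.mk ((c : ℚ_[q])⁻¹ * x), ?_⟩
  rw [← Submodule.Quotient.mk_smul, Algebra.smul_def]
  congr 1
  exact mul_inv_cancel_left₀ (by simpa using hc) x

theorem QmodZ_baer : Module.Baer ℤ_[q] (QmodZ q) := fun I g => by
  obtain ⟨m, rfl⟩ := IsPrincipalIdealRing.principal I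
  obtain rfl | h0 := eq_or_ne m 0
  · refine ⟨0, fun n hn => ?_⟩
    rw [Submodule.span_zero_singleton] at hn
    subst hn
    exact (map_zero g).symm
  obtain ⟨y, hy⟩ := QmodZ_exists_smul_eq q h0 (g ⟨m, Submodule.mem_span_singleton_self m⟩)
  refine ⟨LinearMap.toSpanSingleton ℤ_[q] _ y, fun n hn => ?_⟩
  obtain ⟨n, rfl⟩ := Submodule.mem_span_singleton.mp hn
  rw [LinearMap.toSpanSingleton_apply, smul_assoc, hy, ← map_smul, SetLike.mk_smul_mk]

/-- Characters with values in `ℚ_q/ℤ_q` separate the points of a `ℤ_q`-module. -/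
theorem exists_linearMap_QmodZ_apply_ne_zero {N : Type*} [AddCommGroup N] [Module ℤ_[q] N] {x : N}
    (hx : x ≠ 0) : ∃ f : N →ₗ[ℤ_[q]] QmodZ q, f x ≠ 0 := by
  have hq0 : (q : ℚ_[q]) ≠ 0 := by exact_mod_cast (Fact.out : q.Prime).ne_zero
  let t : QmodZ q := Submodule.Quotient.mk (q : ℚ_[q])⁻¹
  have ht : t ≠ 0 := by
    intro h
    obtain ⟨z, hz⟩ := (Submodule.Quotient.mk_eq_zero _).1 h
    have h1 : (q : ℤ_[q]) * z = 1 := by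
      apply Subtype.coe_injective
      have : (z : ℚ_[q]) = (q : ℚ_[q])⁻¹ := hz
      push_cast
      rw [this, mul_inv_cancel₀ hq0]
    exact PadicInt.prime_p.not_isUnit (IsUnit.of_mul_eq_one _ h1)
  have hqt : (q : ℤ_[q]) • t = 0 := by
    rw [← Submodule.Quotient.mk_smul, Submodule.Quotient.mk_eq_zero, Algebra.smul_def]
    refine ⟨1, ?_⟩
    simp [hq0]
  have hle : Ideal.torsionOf ℤ_[q] N x ≤ LinearMap.ker (LinearMap.toSpanSingleton ℤ_[q] _ t) := by
    have hne : Ideal.torsionOf ℤ_[q] N x ≠ ⊤ := by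
      rwa [Ne, Ideal.torsionOf_eq_top_iff]
    refine (IsLocalRing.le_maximalIdeal hne).trans ?_
    rw [PadicInt.maximalIdeal_eq_span_p, Ideal.span, Submodule.span_singleton_le_iff_mem]
    simpa using hqt
  let φ : (ℤ_[q] ∙ x) →ₗ[ℤ_[q]] QmodZ q :=
    (Submodule.liftQ _ _ hle) ∘ₗ (Ideal.quotTorsionOfEquivSpanSingleton ℤ_[q] N x).symm.toLinearMap
  obtain ⟨f, hf⟩ := (QmodZ_baer q).extension_property (ℤ_[q] ∙ x).subtype
    (Submodule.injective_subtype _) φ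
  refine ⟨f, ?_⟩
  have h1 : f x = φ ⟨x, Submodule.mem_span_singleton_self x⟩ := by rw [← hf]; rfl
  have h2 : (Ideal.quotTorsionOfEquivSpanSingleton ℤ_[q] N x).symm
      ⟨x, Submodule.mem_span_singleton_self x⟩ = Submodule.Quotient.mk 1 := by
    rw [LinearEquiv.symm_apply_eq, Ideal.quotTorsionOfEquivSpanSingleton_apply_mk]
    simp
  rw [h1]
  simp only [φ, LinearMap.comp_apply, LinearEquiv.coe_coe, h2]
  change (1 : ℤ_[q]) • t ≠ 0
  rwa [one_smul]

theorem finite_QmodZ_torsion (n : ℕ) : {x : QmodZ q | (q : ℤ_[q]) ^ n • x = 0}.Finite := by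
  let t : QmodZ q := Submodule.Quotient.mk ((q : ℚ_[q]) ^ n)⁻¹
  have hq0 : (q : ℚ_[q]) ^ n ≠ 0 := by exact_mod_cast pow_ne_zero _ (Fact.out : q.Prime).ne_zero
  have hqt : (q : ℤ_[q]) ^ n • t = 0 := by
    rw [← Submodule.Quotient.mk_smul, Submodule.Quotient.mk_eq_zero, Algebra.smul_def]
    refine ⟨1, ?_⟩
    simp [hq0]
  have : Finite (ℤ_[q] ∙ t) := by
    refine finite_of_pow_smul_eq_zero q n ?_
    rintro ⟨x, hx⟩
    obtain ⟨c, rfl⟩ := Submodule.mem_span_singleton.1 hx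
    ext
    simp [smul_comm _ c, hqt]
  refine (Set.toFinite ((ℤ_[q] ∙ t : Submodule ℤ_[q] (QmodZ q)) : Set (QmodZ q))).subset ?_
  intro x hx
  obtain ⟨x, rfl⟩ := Submodule.Quotient.mk_surjective _ x
  rw [Set.mem_ofPred_eq, ← Submodule.Quotient.mk_smul, Submodule.Quotient.mk_eq_zero,
    Algebra.smul_def] at hx
  obtain ⟨z, hz⟩ := hx
  refine Submodule.mem_span_singleton.2 ⟨z, ?_⟩
  rw [← Submodule.Quotient.mk_smul, Algebra.smul_def]
  congr 1
  have hz' : algebraMap ℤ_[q] ℚ_[q] z = (q : ℚ_[q]) ^ n * x := by simpa using hz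
  rw [hz', mul_comm, inv_mul_cancel_left₀ hq0]

theorem finite_linearMap_QmodZ_torsion (N : Type*) [AddCommGroup N] [Module ℤ_[q] N]
    [Module.Finite ℤ_[q] N] (n : ℕ) :
    {f : N →ₗ[ℤ_[q]] QmodZ q | ∀ x, (q : ℤ_[q]) ^ n • f x = 0}.Finite := by
  obtain ⟨k, g, hg⟩ := Module.Finite.exists_fin (R := ℤ_[q]) (M := N)
  refine Set.Finite.of_finite_image (f := fun f : N →ₗ[ℤ_[q]] QmodZ q => fun i : Fin k => f (g i))
    ((Set.Finite.pi' fun _ : Fin k => finite_QmodZ_torsion q n).subset ?_) ?_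
  · rintro _ ⟨f, hf, rfl⟩ i
    exact hf _
  · intro f _ f' _ h
    refine LinearMap.ext_on_range hg fun i => congrFun h i

end Padic

section Dual

theorem dualModule_smul_apply (a : A) (f : M →ₗ[ℤ_[q]] QmodZ q) (m : M) :
    (a • f) m = f (a • m) := rfl

theorem natCast_pow_smul_eq_padic (n : ℕ) (m : M) :
    (q : A) ^ n • m = (q : ℤ_[q]) ^ n • m := by
  rw [← algebraMap_smul A ((q : ℤ_[q]) ^ n) m]
  simp

theorem mem_range_pow_smul_of_forall_dual_eq_zero (k : ℕ) {x : M}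
    (h : ∀ f : M →ₗ[ℤ_[q]] QmodZ q, (∀ m, (q : ℤ_[q]) ^ k • f m = 0) → f x = 0) :
    ∃ m : M, (q : ℤ_[q]) ^ k • m = x := by
  by_contra hx
  let P : Submodule ℤ_[q] M := LinearMap.range (LinearMap.lsmul ℤ_[q] M ((q : ℤ_[q]) ^ k))
  have hxP : P.mkQ x ≠ 0 := by
    rw [Ne, Submodule.mkQ_apply, Submodule.Quotient.mk_eq_zero]
    exact hx
  obtain ⟨f, hf⟩ := exists_linearMap_QmodZ_apply_ne_zero q hxP
  refine hf (h (f ∘ₗ P.mkQ) fun m => ?_)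
  have hm : P.mkQ ((q : ℤ_[q]) ^ k • m) = 0 := (Submodule.Quotient.mk_eq_zero P).2 ⟨m, rfl⟩
  rw [← map_smul, LinearMap.comp_apply, hm, map_zero]

variable [Module.Finite ℤ_[q] A] [Module.Finite A M] (S : Submonoid A)

theorem finite_localizedModule_of_smul_pow_smul_eq_zero {s : A} (hs : s ∈ S) (n : ℕ)
    (h : ∀ m : M, s • (q : A) ^ n • m = 0) : Finite (LocalizedModule S M) := by
  have : Module.Finite ℤ_[q] M := Module.Finite.trans A M
  refine finite_localizedModule_of_finite_range_smul S hs ?_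
  have : Finite (LinearMap.range (smulLin (q := q) (M := M) s)) := by
    refine finite_of_pow_smul_eq_zero q n ?_
    rintro ⟨_, m, rfl⟩
    ext
    change (q : ℤ_[q]) ^ n • s • m = 0
    rw [← natCast_pow_smul_eq_padic (A := A), smul_comm, h]
  exact this

theorem finite_localizedModule_dual_of_smul_pow_smul_eq_zero {s : A} (hs : s ∈ S) (n : ℕ)
    (h : ∀ m : M, s • (q : A) ^ n • m = 0) :
    Finite (LocalizedModule S (M →ₗ[ℤ_[q]] QmodZ q)) := by
  have : Module.Finite ℤ_[q] M := Module.Finite.trans A M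
  refine finite_localizedModule_of_finite_range_smul S hs
    ((finite_linearMap_QmodZ_torsion q M n).subset ?_)
  rintro _ ⟨f, rfl⟩ m
  change (q : ℤ_[q]) ^ n • f (s • m) = 0
  rw [← map_smul, ← natCast_pow_smul_eq_padic (A := A), smul_comm, h, map_zero]

theorem exists_smul_pow_smul_mem_range_of_finite_dual
    (n : ℕ) (hn : ∀ x : LocalizedModule S (M →ₗ[ℤ_[q]] QmodZ q), (q : A) ^ n • x = 0) (k : ℕ) :
    ∃ s ∈ S, ∀ m : M, ∃ m' : M, (q : A) ^ k • m' = s • (q : A) ^ n • m := by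
  have : Module.Finite ℤ_[q] M := Module.Finite.trans A M
  have h' : ∀ f : M →ₗ[ℤ_[q]] QmodZ q, ∃ u : S, (u : A) • (q : A) ^ n • f = 0 := by
    intro f
    have := hn (LocalizedModule.mk f 1)
    rw [LocalizedModule.smul'_mk, ← LocalizedModule.zero_mk (1 : S), LocalizedModule.mk_eq] at this
    obtain ⟨u, hu⟩ := this
    refine ⟨u, ?_⟩
    rwa [one_smul, smul_zero, smul_zero] at hu
  choose u hu using h'
  let F := (finite_linearMap_QmodZ_torsion q M k).toFinset
  refine ⟨((∏ f ∈ F, u f : S) : A), (∏ f ∈ F, u f).2, fun m => ?_⟩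
  simp only [natCast_pow_smul_eq_padic (q := q) (A := A) k]
  refine mem_range_pow_smul_of_forall_dual_eq_zero k fun f hf => ?_
  have hfF : f ∈ F := by simpa [F] using hf
  classical
  rw [← Finset.mul_prod_erase _ _ hfF, mul_comm, Submonoid.coe_mul, mul_smul, smul_comm,
    smul_comm _ ((q : A) ^ n)]
  have := LinearMap.congr_fun (hu f) (((∏ x ∈ F.erase f, u x : S) : A) • m)
  simpa only [dualModule_smul_apply, smul_comm ((q : A) ^ n), LinearMap.zero_apply] using this

theorem exists_smul_pow_smul_eq_zero_of_finite_dual (𝔮 : Ideal A) [𝔮.IsMaximal]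
    [Finite (LocalizedModule 𝔮.primeCompl (M →ₗ[ℤ_[q]] QmodZ q))] :
    ∃ s ∈ 𝔮.primeCompl, ∃ n : ℕ, ∀ m : M, s • (q : A) ^ n • m = 0 := by
  obtain ⟨n, hn⟩ := exists_natCast_pow_smul_eq_zero q (A := A)
    (P := LocalizedModule 𝔮.primeCompl (M →ₗ[ℤ_[q]] QmodZ q))
  have : IsNoetherianRing A := IsNoetherianRing.of_finite ℤ_[q] A
  let B := Localization.AtPrime 𝔮
  have : IsNoetherianRing B := IsLocalization.isNoetherianRing 𝔮.primeCompl B inferInstance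
  have : Module.Finite B (LocalizedModule 𝔮.primeCompl M) :=
    Module.Finite.of_isLocalizedModule 𝔮.primeCompl (LocalizedModule.mkLinearMap 𝔮.primeCompl M)
  have hbot := Ideal.iInf_pow_smul_eq_bot_of_isLocalRing
    (M := LocalizedModule 𝔮.primeCompl M) (IsLocalRing.maximalIdeal B) Ideal.IsPrime.ne_top'
  have hqB : algebraMap A B q ∈ IsLocalRing.maximalIdeal B :=
    (IsLocalization.AtPrime.to_map_mem_maximal_iff B 𝔮 _).2 (natCast_prime_mem_of_isMaximal q 𝔮)
  obtain ⟨s, hs, h⟩ := exists_smul_eq_zero_of_mk_eq_zero 𝔮.primeCompl ((q : A) ^ n) (N := M)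
    fun x => by
      rw [← Submodule.mem_bot B, ← hbot, Submodule.mem_iInf]
      intro k
      obtain ⟨s, hs, h⟩ := exists_smul_pow_smul_mem_range_of_finite_dual 𝔮.primeCompl n hn k
      obtain ⟨m', hm'⟩ := h x
      have : LocalizedModule.mk ((q : A) ^ n • x) (1 : 𝔮.primeCompl) =
          (algebraMap A B q) ^ k • LocalizedModule.mk m' (⟨s, hs⟩ : 𝔮.primeCompl) := by
        rw [← map_pow, algebraMap_smul, LocalizedModule.smul'_mk, hm']
        exact (LocalizedModule.mk_cancel (⟨s, hs⟩ : 𝔮.primeCompl) _).symm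
      rw [this]
      exact Submodule.smul_mem_smul (Ideal.pow_mem_pow hqB k) Submodule.mem_top
  exact ⟨s, hs, n, h⟩

end Dual

/-- Let `A` be a commutative `ℤ_q`-algebra, finite free as a `ℤ_q`-module,
and `M` a finitely generated `A`-module. For every maximal ideal `𝔮` of `A`, the
localization `M_𝔮` is finite iff the localization of the Pontryagin dual
`Hom_{ℤ_q}(M, ℚ_q/ℤ_q)` at `𝔮` is finite. -/
theorem statement7 (q : ℕ) (hq : q.Prime) [Fact q.Prime]
    (A : Type*) [CommRing A] [Algebra ℤ_[q] A] [Module.Finite ℤ_[q] A] [Module.Free ℤ_[q] A]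
    (M : Type*) [AddCommGroup M] [Module A M] [Module ℤ_[q] M] [IsScalarTower ℤ_[q] A M]
    [Module.Finite A M]
    (𝔮 : Ideal A) [𝔮.IsMaximal] :
    Finite (LocalizedModule 𝔮.primeCompl M) ↔
      Finite (LocalizedModule 𝔮.primeCompl (M →ₗ[ℤ_[q]] QmodZ q)) := by
  constructor
  · intro h
    obtain ⟨s, hs, n, hn⟩ := exists_smul_pow_smul_eq_zero_of_finite q (N := M) 𝔮.primeCompl
    exact finite_localizedModule_dual_of_smul_pow_smul_eq_zero 𝔮.primeCompl hs n hn
  · intro h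
    obtain ⟨s, hs, n, hn⟩ := exists_smul_pow_smul_eq_zero_of_finite_dual (q := q) (M := M) 𝔮
    exact finite_localizedModule_of_smul_pow_smul_eq_zero (q := q) 𝔮.primeCompl hs n hn

end
end

section
/- Let ℓ be an odd prime, let (a_n)_{n≥0} be a sequence of ℓ-adic integers with a₀ a unit of ℤ_ℓ, and let x, y ∈ ℚ_ℓ with |x|_ℓ ≤ ℓ⁻¹ and |y|_ℓ ≤ ℓ⁻¹. Then the family (a_n·(x^{n+1} − y^{n+1})/(n+1))_{n≥0} is summable in ℚ_ℓ, and if its sum Σ_{n=0}^∞ a_n·(x^{n+1} − y^{n+1})/(n+1) equals 0, then x = y. -/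
lemma Padic.norm_inv_natCast_le (p : ℕ) [Fact p.Prime] (m : ℕ) :
    ‖((m : ℚ_[p]))⁻¹‖ ≤ m := by
  rcases eq_or_ne m 0 with rfl | hm
  · simp
  rw [norm_inv, Padic.norm_eq_zpow_neg_valuation (Nat.cast_ne_zero.mpr hm),
    Padic.valuation_natCast, zpow_neg, inv_inv, zpow_natCast]
  exact_mod_cast Nat.le_of_dvd (Nat.pos_of_ne_zero hm) pow_padicValNat_dvd

lemma IsUltrametricDist.norm_pow_succ_sub_pow_succ_le {K : Type*} [NormedField K]
    [IsUltrametricDist K] {x y : K} {r : ℝ} (hr : 0 ≤ r) (hx : ‖x‖ ≤ r) (hy : ‖y‖ ≤ r) (n : ℕ) :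
    ‖x ^ (n + 1) - y ^ (n + 1)‖ ≤ ‖x - y‖ * r ^ n := by
  rw [← geom_sum₂_mul, norm_mul, mul_comm]
  refine mul_le_mul_of_nonneg_left ?_ (norm_nonneg _)
  refine IsUltrametricDist.norm_sum_le_of_forall_le_of_nonneg (pow_nonneg hr n) fun i hi => ?_
  have hi' : i + (n + 1 - 1 - i) = n := by
    have := Finset.mem_range.mp hi
    omega
  calc ‖x ^ i * y ^ (n + 1 - 1 - i)‖ = ‖x‖ ^ i * ‖y‖ ^ (n + 1 - 1 - i) := by simp
    _ ≤ r ^ i * r ^ (n + 1 - 1 - i) := by gcongr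
    _ = r ^ n := by rw [← pow_add, hi']

lemma Padic.norm_integral_term_le {p : ℕ} [Fact p.Prime] (a : ℤ_[p]) {x y : ℚ_[p]} {r : ℝ}
    (hr : 0 ≤ r) (hx : ‖x‖ ≤ r) (hy : ‖y‖ ≤ r) (n : ℕ) :
    ‖(a : ℚ_[p]) * (x ^ (n + 1) - y ^ (n + 1)) / ((n : ℚ_[p]) + 1)‖ ≤
      ‖x - y‖ * (((n : ℝ) + 1) * r ^ n) := by
  have hinv : ‖((n : ℚ_[p]) + 1)⁻¹‖ ≤ (n : ℝ) + 1 := by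
    simpa using Padic.norm_inv_natCast_le p (n + 1)
  have hpow := IsUltrametricDist.norm_pow_succ_sub_pow_succ_le hr hx hy n
  rw [div_eq_mul_inv, norm_mul, norm_mul]
  calc ‖(a : ℚ_[p])‖ * ‖x ^ (n + 1) - y ^ (n + 1)‖ * ‖((n : ℚ_[p]) + 1)⁻¹‖
      ≤ 1 * (‖x - y‖ * r ^ n) * ((n : ℝ) + 1) := by
        gcongr
        exact a.norm_le_one
    _ = ‖x - y‖ * (((n : ℝ) + 1) * r ^ n) := by ring

lemma add_two_mul_pow_succ_le {r : ℝ} (hr : 0 ≤ r) (hr3 : r ≤ 1 / 3) (n : ℕ) :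
    ((n : ℝ) + 2) * r ^ (n + 1) ≤ 2 / 3 := by
  induction n with
  | zero => norm_num; linarith
  | succ n ih =>
    refine le_trans ?_ ih
    have hn : ((n : ℝ) + 3) * r ≤ n + 2 := by
      have : (0 : ℝ) ≤ n := n.cast_nonneg
      nlinarith
    calc (((n + 1 : ℕ) : ℝ) + 2) * r ^ (n + 1 + 1) = ((n : ℝ) + 3) * r * r ^ (n + 1) := by
          push_cast; ring
      _ ≤ ((n : ℝ) + 2) * r ^ (n + 1) := by gcongr


/-- Let `ℓ` be an odd prime, `(a_n)` a sequence of `ℓ`-adic integers with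
`a₀` a unit, and `x, y ∈ ℚ_ℓ` with `|x|, |y| ≤ ℓ⁻¹`. Then the family
`a_n·(x^{n+1} − y^{n+1})/(n+1)` is summable, and if its sum is `0` then `x = y`. -/
theorem statement8 (ℓ : ℕ) (hℓ : ℓ.Prime) [Fact ℓ.Prime] (hodd : ℓ ≠ 2)
    (a : ℕ → ℤ_[ℓ]) (ha : IsUnit (a 0))
    (x y : ℚ_[ℓ]) (hx : ‖x‖ ≤ (ℓ : ℝ)⁻¹) (hy : ‖y‖ ≤ (ℓ : ℝ)⁻¹) :
    Summable (fun n : ℕ => (a n : ℚ_[ℓ]) * (x ^ (n + 1) - y ^ (n + 1)) / ((n : ℚ_[ℓ]) + 1)) ∧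
      ((∑' n : ℕ, (a n : ℚ_[ℓ]) * (x ^ (n + 1) - y ^ (n + 1)) / ((n : ℚ_[ℓ]) + 1)) = 0 →
        x = y) := by
  have hr : (0 : ℝ) ≤ (ℓ : ℝ)⁻¹ := by positivity
  have hr3 : (ℓ : ℝ)⁻¹ ≤ 1 / 3 := by
    have : 3 ≤ ℓ := by have := hℓ.two_le; omega
    rw [← one_div]
    exact one_div_le_one_div_of_le (by norm_num) (by exact_mod_cast this)
  have hbound := fun n => Padic.norm_integral_term_le (a n) hr hx hy n
  have hgeom : Summable fun n : ℕ => ((n : ℝ) + 1) * (ℓ : ℝ)⁻¹ ^ n := by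
    have hlt : ‖(ℓ : ℝ)⁻¹‖ < 1 := by rw [Real.norm_of_nonneg hr]; linarith
    simpa [add_mul] using (summable_pow_mul_geometric_of_norm_lt_one 1 hlt).add
      (summable_geometric_of_norm_lt_one hlt)
  have hsum := Summable.of_norm_bounded (hgeom.mul_left ‖x - y‖) hbound
  refine ⟨hsum, fun h0 => ?_⟩
  rw [hsum.tsum_eq_zero_add, add_eq_zero_iff_eq_neg] at h0
  have hunit : ‖(a 0 : ℚ_[ℓ])‖ = 1 := PadicInt.isUnit_iff.mp ha
  have htail : ‖x - y‖ ≤ ‖x - y‖ * (2 / 3) := by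
    calc ‖x - y‖ = ‖(a 0 : ℚ_[ℓ]) * (x ^ (0 + 1) - y ^ (0 + 1)) / (((0 : ℕ) : ℚ_[ℓ]) + 1)‖ := by
          simp [hunit]
      _ ≤ ‖x - y‖ * (2 / 3) := by
          rw [h0, norm_neg]
          refine IsUltrametricDist.norm_tsum_le_of_forall_le fun n => (hbound (n + 1)).trans ?_
          refine mul_le_mul_of_nonneg_left ?_ (norm_nonneg _)
          have hn := add_two_mul_pow_succ_le hr hr3 n
          push_cast
          linarith
  have hzero : ‖x - y‖ = 0 := by linarith [norm_nonneg (x - y)]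
  exact sub_eq_zero.mp (norm_eq_zero.mp hzero)
end

section
/- Let p be an odd prime, ε ∈ (ℤ/pℤ)^× a quadratic non-residue, B ≤ GL₂(𝔽_p) the subgroup of invertible upper-triangular matrices, and C_ε the standard non-split Cartan subgroup of GL₂(𝔽_p). Then B ∩ C_ε equals the subgroup of nonzero scalar matrices {λ·I : λ ∈ 𝔽_p^×}, and GL₂(𝔽_p) = B·C_ε, i.e. every element of GL₂(𝔽_p) can be written as a product b·c with b ∈ B and c ∈ C_ε. -/
/-- Membership in the Borel subgroup `B` of invertible upper-triangular matrices. -/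
def memBorel {p : ℕ} (g : GL2 p) : Prop :=
  (g : Matrix (Fin 2) (Fin 2) (ZMod p)) 1 0 = 0

/-- The norm form `x² - ε y²` is anisotropic when `ε` is a non-square unit. -/
theorem mul_self_sub_mul_ne_zero_of_not_isSquare {K : Type*} [Field K] {ε : Kˣ}
    (hε : ¬IsSquare ε) {x y : K} (hxy : ¬(x = 0 ∧ y = 0)) :
    x * x - y * ε * y ≠ 0 := by
  intro h
  by_cases hy : y = 0
  · subst hy
    exact hxy ⟨by simpa using h, rfl⟩
  · have hsq : (ε : K) = x / y * (x / y) := by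
      field_simp
      linear_combination -h
    have hne : x / y ≠ 0 := fun h0 => ε.ne_zero (by rw [hsq, h0, mul_zero])
    exact hε ⟨Units.mk0 _ hne, Units.ext hsq⟩

/-- Matrices with the same bottom row differ by left multiplication by an upper-triangular
matrix. -/
theorem memBorel_mul_inv_of_row_eq {p : ℕ} {g c : GL2 p}
    (h : ∀ j, (g : Matrix (Fin 2) (Fin 2) (ZMod p)) 1 j =
      (c : Matrix (Fin 2) (Fin 2) (ZMod p)) 1 j) : memBorel (g * c⁻¹) := by
  have hc : ((c * c⁻¹ : GL2 p) : Matrix (Fin 2) (Fin 2) (ZMod p)) 1 0 = 0 := by simp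
  rw [Units.val_mul, Matrix.mul_apply] at hc
  rw [memBorel, Units.val_mul, Matrix.mul_apply]
  simpa only [h] using hc

/-- For an odd prime `p` and a quadratic non-residue `ε`, the intersection
of the upper-triangular Borel subgroup `B` with the standard non-split Cartan subgroup `C_ε`
is the subgroup of nonzero scalar matrices, and `GL₂(𝔽_p) = B · C_ε`. -/
theorem statement11 (p : ℕ) (hp : p.Prime) [Fact p.Prime] (hodd : p ≠ 2)
    (ε : (ZMod p)ˣ) (hε : ¬IsSquare ε) :
    (∀ g : GL2 p, (memBorel g ∧ memStdCartan (ε : ZMod p) g) ↔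
      ∃ lam : ZMod p, lam ≠ 0 ∧
        (g : Matrix (Fin 2) (Fin 2) (ZMod p)) = lam • (1 : Matrix (Fin 2) (Fin 2) (ZMod p))) ∧
    (∀ g : GL2 p, ∃ b c : GL2 p, memBorel b ∧ memStdCartan (ε : ZMod p) c ∧ g = b * c) := by
  refine ⟨fun g => ⟨?_, ?_⟩, fun g => ?_⟩
  · rintro ⟨hB, a, b, hab, hg⟩
    obtain rfl : b = 0 := by simpa [memBorel, hg] using hB
    refine ⟨a, fun ha => hab ⟨ha, rfl⟩, ?_⟩
    rw [hg]
    ext i j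
    fin_cases i <;> fin_cases j <;> simp
  · rintro ⟨a, ha, hg⟩
    refine ⟨by simp [memBorel, hg], a, 0, fun h => ha h.1, ?_⟩
    rw [hg]
    ext i j
    fin_cases i <;> fin_cases j <;> simp
  · set M : Matrix (Fin 2) (Fin 2) (ZMod p) := g.val with hM
    have hrow : ¬(M 1 1 = 0 ∧ M 1 0 = 0) := by
      rintro ⟨h1, h0⟩
      have hdet : M.det ≠ 0 := ((Matrix.isUnit_iff_isUnit_det M).1 g.isUnit).ne_zero
      exact hdet (by rw [Matrix.det_fin_two, h1, h0]; ring)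
    let c : GL2 p := Matrix.GeneralLinearGroup.mkOfDetNeZero
      !![M 1 1, M 1 0 * ε; M 1 0, M 1 1] (by
        rw [Matrix.det_fin_two_of]
        exact mul_self_sub_mul_ne_zero_of_not_isSquare hε hrow)
    have hc : (c : Matrix (Fin 2) (Fin 2) (ZMod p)) =
        !![M 1 1, M 1 0 * ε; M 1 0, M 1 1] := rfl
    refine ⟨g * c⁻¹, c, memBorel_mul_inv_of_row_eq fun j => ?_, ⟨_, _, hrow, hc⟩, by group⟩
    rw [hc]
    fin_cases j <;> simp [hM]
end

section
/- Let p ≥ 5 be a prime with p ≡ 2 (mod 3) and let g ∈ GL₂(𝔽_p). Then: (i) g has order 3 if and only if the trace of g equals −1 and the determinant of g equals 1; (ii) there exists λ ∈ 𝔽_p^× such that the matrix λ·g has order 3 if and only if (trace of g)² equals the determinant of g. -/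
/-- The scalar matrix `λ·I`, as an element of `GL₂(𝔽_p)`, for `λ ∈ 𝔽_pˣ`. -/
def scalarGL2 {p : ℕ} (lam : (ZMod p)ˣ) : GL2 p :=
  Units.map (algebraMap (ZMod p) (Matrix (Fin 2) (Fin 2) (ZMod p))).toMonoidHom lam

theorem ZMod.eq_one_of_pow_three_eq_one {p : ℕ} [Fact p.Prime] (hp3 : p % 3 = 2) {x : ZMod p}
    (hx : x ^ 3 = 1) : x = 1 := by
  have hx0 : x ≠ 0 := by
    rintro rfl
    simp at hx
  have hpow := ZMod.pow_card_sub_one_eq_one hx0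
  have hdiv : p - 1 = 3 * (p / 3) + 1 := by omega
  rwa [hdiv, pow_succ, pow_mul, hx, one_pow, one_mul] at hpow

theorem Matrix.sq_eq_trace_smul_sub_det_smul_one {R : Type*} [CommRing R]
    (M : Matrix (Fin 2) (Fin 2) R) : M ^ 2 = M.trace • M - M.det • 1 := by
  ext i j
  fin_cases i <;> fin_cases j <;>
    simp [pow_two, Matrix.mul_apply, Fin.sum_univ_two, Matrix.trace_fin_two,
      Matrix.det_fin_two] <;> ring

/-- Over a field of characteristic different from `3` without nontrivial cube roots of unity,
the `2×2` matrices of order `3` are those with characteristic polynomial `X² + X + 1`. -/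
theorem Matrix.orderOf_eq_three_iff {F : Type*} [Field F] (h3 : (3 : F) ≠ 0)
    (hcube : ∀ x : F, x ^ 3 = 1 → x = 1) (M : Matrix (Fin 2) (Fin 2) F) :
    orderOf M = 3 ↔ M.trace = -1 ∧ M.det = 1 := by
  have : Fact (Nat.Prime 3) := ⟨Nat.prime_three⟩
  rw [orderOf_eq_prime_iff]
  have hCH := M.sq_eq_trace_smul_sub_det_smul_one
  constructor
  · rintro ⟨hM3, hM1⟩
    have hdet : M.det = 1 := hcube _ (by rw [← Matrix.det_pow, hM3, Matrix.det_one])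
    refine ⟨?_, hdet⟩
    rw [hdet, one_smul] at hCH
    have hfactor : (M.trace + 1) • ((M.trace - 1) • M - 1) = 0 := by
      have hM3' : M * M ^ 2 = 1 := by rw [← pow_succ', hM3]
      rw [hCH, mul_sub, mul_smul_comm, ← pow_two, hCH, mul_one] at hM3'
      rw [← sub_eq_zero.mpr hM3']
      module
    rcases smul_eq_zero.mp hfactor with ht | hM
    · exact eq_neg_of_add_eq_zero_left ht
    · exfalso
      have hM' : (M.trace - 1) • M = 1 := sub_eq_zero.mp hM
      have hc : M.trace - 1 = 1 := by
        apply hcube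
        have h := congrArg (· ^ 3) hM'
        simp only [smul_pow, hM3, one_pow] at h
        simpa using congrFun (congrFun h 0) 0
      exact hM1 (by rwa [hc, one_smul] at hM')
  · rintro ⟨ht, hd⟩
    rw [ht, hd] at hCH
    constructor
    · rw [pow_succ', hCH, mul_sub, mul_smul_comm, ← pow_two, hCH, mul_smul_comm, mul_one]
      module
    · rintro rfl
      apply h3
      rw [Matrix.trace_one, Fintype.card_fin] at ht
      push_cast at ht
      linear_combination ht

theorem coe_scalarGL2_mul {p : ℕ} (lam : (ZMod p)ˣ) (g : GL2 p) :
    ((scalarGL2 lam * g : GL2 p) : Matrix (Fin 2) (Fin 2) (ZMod p)) =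
      (lam : ZMod p) • (g : Matrix (Fin 2) (Fin 2) (ZMod p)) :=
  (Algebra.smul_def _ _).symm

/-- Let `p ≥ 5` be a prime with `p ≡ 2 (mod 3)` and `g ∈ GL₂(𝔽_p)`. Then
(i) `g` has order `3` iff `tr g = -1` and `det g = 1`; and (ii) some scalar multiple `λ·g`
(`λ ∈ 𝔽_pˣ`) has order `3` iff `(tr g)² = det g`. -/
theorem statement12 (p : ℕ) (hp : p.Prime) [Fact p.Prime] (hp5 : 5 ≤ p) (hp3 : p % 3 = 2)
    (g : GL2 p) :
    (orderOf g = 3 ↔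
      Matrix.trace (g : Matrix (Fin 2) (Fin 2) (ZMod p)) = -1 ∧
        Matrix.det (g : Matrix (Fin 2) (Fin 2) (ZMod p)) = 1) ∧
    ((∃ lam : (ZMod p)ˣ, orderOf (scalarGL2 lam * g) = 3) ↔
      Matrix.trace (g : Matrix (Fin 2) (Fin 2) (ZMod p)) ^ 2 =
        Matrix.det (g : Matrix (Fin 2) (Fin 2) (ZMod p))) := by
  have h3 : (3 : ZMod p) ≠ 0 := by
    intro h
    have hdvd : p ∣ 3 := (ZMod.natCast_eq_zero_iff 3 p).mp (by exact_mod_cast h)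
    have := Nat.le_of_dvd (by norm_num) hdvd
    omega
  have key : ∀ h : GL2 p, orderOf h = 3 ↔
      Matrix.trace (h : Matrix (Fin 2) (Fin 2) (ZMod p)) = -1 ∧
        Matrix.det (h : Matrix (Fin 2) (Fin 2) (ZMod p)) = 1 := fun h => by
    rw [← orderOf_units]
    exact Matrix.orderOf_eq_three_iff h3 (fun _ => ZMod.eq_one_of_pow_three_eq_one hp3) _
  refine ⟨key g, ?_⟩
  simp only [key, coe_scalarGL2_mul, Matrix.trace_smul, Matrix.det_smul, Fintype.card_fin,
    smul_eq_mul]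
  constructor
  · rintro ⟨lam, ht, hd⟩
    apply mul_left_cancel₀ (pow_ne_zero 2 lam.ne_zero)
    rw [← mul_pow, ht, hd, neg_one_sq]
  · intro h
    have hdet : Matrix.det (g : Matrix (Fin 2) (Fin 2) (ZMod p)) ≠ 0 :=
      ((Matrix.isUnit_iff_isUnit_det _).mp g.isUnit).ne_zero
    have ht : Matrix.trace (g : Matrix (Fin 2) (Fin 2) (ZMod p)) ≠ 0 := by
      intro h0
      exact hdet (by rw [← h, h0, zero_pow two_ne_zero])
    refine ⟨-(Units.mk0 _ ht)⁻¹, ?_, ?_⟩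
    · simp [ht]
    · rw [← h, ← mul_pow]
      simp [ht]
end

section
/- Let p ≥ 5 be a prime with p ≡ 2 (mod 3), let z ∈ (ℤ/pℤ)^× be a quadratic non-residue, and let s be an element of the field 𝔽_{p²} with p² elements (containing 𝔽_p = ℤ/pℤ) such that s² = z. Then 1 + b·s ≠ 0 for every b ∈ 𝔽_p, and counting elements of 𝔽_p according to the coset of 1 + b·s modulo the subgroup (𝔽_{p²}^×)³ of cubes of 𝔽_{p²}^×: exactly (p−2)/3 elements b ∈ 𝔽_p satisfy 1 + b·s ∈ (𝔽_{p²}^×)³, while for each of the two non-trivial cosets t of (𝔽_{p²}^×)³ in 𝔽_{p²}^×, exactly (p+1)/3 elements b ∈ 𝔽_p satisfy 1 + b·s ∈ t. -/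
open scoped Classical

noncomputable section

/-- The subgroup of cubes in `𝔽_{p²}ˣ`. -/
def cubeSubgroup (p : ℕ) [Fact p.Prime] : Subgroup (GaloisField p 2)ˣ :=
  (powMonoidHom 3 : (GaloisField p 2)ˣ →* (GaloisField p 2)ˣ).range

/-- The set of cosets of `𝔽_{p²}ˣ` modulo its subgroup of cubes. -/
abbrev CubeCosets (p : ℕ) [Fact p.Prime] := (GaloisField p 2)ˣ ⧸ cubeSubgroup p

/-- The statement that `1 + b·s` is nonzero and lies in the coset `t` of the cubes. -/
def memCoset (p : ℕ) [Fact p.Prime] (s : GaloisField p 2) (b : ZMod p) (t : CubeCosets p) :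
    Prop :=
  ∃ h : 1 + algebraMap (ZMod p) (GaloisField p 2) b * s ≠ 0,
    (QuotientGroup.mk (Units.mk0 _ h) : CubeCosets p) = t

/-- If `s ^ 2 = z` with `z` a non-square of `F`, then `1` and `s` are independent over `F`. -/
lemma eq_zero_of_add_mul_sqrt_eq_zero {F K : Type*} [Field F] [Field K] [Algebra F K] {z : F}
    (hz : ¬IsSquare z) {s : K} (hs : s ^ 2 = algebraMap F K z) {x y : F}
    (h : algebraMap F K x + algebraMap F K y * s = 0) : x = 0 ∧ y = 0 := by
  have hy : y = 0 := by
    by_contra hy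
    refine hz ⟨x / y, ?_⟩
    have hy' : algebraMap F K y ≠ 0 := by simpa using hy
    have hs' : s = -(algebraMap F K x / algebraMap F K y) := by
      field_simp
      linear_combination h
    apply (algebraMap F K).injective
    rw [← hs, hs', map_mul, map_div₀]
    ring
  subst hy
  simpa using h

/-- If a finite group is parametrised by `O × A` compatibly with a choice `u : O → G` of coset
representatives, then the number of `o` with `u o` in a given coset is `|H| / |A|`. -/
lemma ncard_coset_mul_card {G A O : Type*} [Group G] (H : Subgroup G) (e : O × A ≃ G) (u : O → G)
    (h : ∀ o a, (QuotientGroup.mk (e (o, a)) : G ⧸ H) = QuotientGroup.mk (u o)) (t : G ⧸ H) :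
    {o | (QuotientGroup.mk (u o) : G ⧸ H) = t}.ncard * Nat.card A = Nat.card H := by
  have e₁ := QuotientGroup.preimageMkEquivSubgroupProdSet H {t}
  have e₂ : {o | (QuotientGroup.mk (u o) : G ⧸ H) = t} × A ≃
      (QuotientGroup.mk ⁻¹' {t} : Set G) :=
    { toFun := fun x => ⟨e (x.1, x.2), (h x.1 x.2).trans x.1.2⟩
      invFun := fun g => (⟨(e.symm g).1, by
        have := h (e.symm g).1 (e.symm g).2
        rw [Prod.mk.eta, e.apply_symm_apply] at this
        exact this.symm.trans g.2⟩, (e.symm g).2)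
      left_inv := fun x => by simp
      right_inv := fun g => by simp }
  have := Nat.card_congr (e₂.trans e₁)
  rw [Nat.card_prod, Nat.card_prod] at this
  simpa using this

/-- The points `1 + b * s` and `s` represent all of `Kˣ / Fˣ` when `K = F(s)` is quadratic. -/
def lineRep {F K : Type*} [Field F] [Field K] [Algebra F K] (s : Kˣ)
    (h : ∀ b : F, 1 + algebraMap F K b * s ≠ 0) : Option F → Kˣ
  | none => s
  | some b => Units.mk0 _ (h b)

lemma bijective_smul_lineRep {F K : Type*} [Field F] [Field K] [Algebra F K] [Finite F] [Finite K]
    (hcard : Nat.card K = Nat.card F ^ 2) {z : F} (hz : ¬IsSquare z) (s : Kˣ)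
    (hs : (s : K) ^ 2 = algebraMap F K z) (h : ∀ b : F, 1 + algebraMap F K b * s ≠ 0) :
    Function.Bijective fun x : Option F × Fˣ =>
      Units.map (algebraMap F K : F →* K) x.2 * lineRep s h x.1 := by
  have ind {x y : F} := eq_zero_of_add_mul_sqrt_eq_zero hz hs (x := x) (y := y)
  rw [Nat.bijective_iff_injective_and_card]
  constructor
  · rintro ⟨_ | b, a⟩ ⟨_ | b', a'⟩ hx <;> have hx := congrArg Units.val hx <;>
      simp [lineRep] at hx
    · simpa [Units.ext_iff] using hx
    · have := ind (x := -a') (y := a - a' * b') (by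
        simp only [map_neg, map_sub, map_mul]; linear_combination hx)
      simp at this
    · have := ind (x := a) (y := a * b - a') (by
        simp only [map_sub, map_mul]; linear_combination hx)
      simp at this
    · have := ind (x := a - a') (y := a * b - a' * b') (by
        simp only [map_sub, map_mul]; linear_combination hx)
      obtain ⟨h₁, h₂⟩ := this
      obtain rfl : a = a' := Units.ext (sub_eq_zero.mp h₁)
      simpa [← mul_sub, sub_eq_zero] using h₂
  · have := Finite.one_lt_card (α := F)
    rw [Nat.card_prod, Nat.card_units, Nat.card_units, hcard, Finite.card_option]
    simpa using (Nat.sq_sub_sq (Nat.card F) 1).symm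

lemma ncard_option_setOf {α : Type*} [Finite α] (P : Option α → Prop) :
    {o | P o}.ncard = {a | P (some a)}.ncard + if P none then 1 else 0 := by
  have himg : (some '' {a | P (some a)}).ncard = {a | P (some a)}.ncard :=
    Set.ncard_image_of_injective _ (Option.some_injective α)
  split_ifs with hn
  · rw [← himg, ← Set.ncard_insert_of_notMem (a := none) (by simp)]
    congr 1
    ext (_ | a) <;> simp [hn]
  · rw [add_zero, ← himg]
    congr 1
    ext (_ | a) <;> simp [hn]

lemma card_cubeSubgroup (p : ℕ) [Fact p.Prime] (hp3 : p % 3 = 2) :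
    Nat.card (cubeSubgroup p) * 3 = p ^ 2 - 1 := by
  have hcard : Nat.card (GaloisField p 2)ˣ = p ^ 2 - 1 := by
    rw [Nat.card_units, GaloisField.card p 2 two_ne_zero]
  have hdvd : 3 ∣ p ^ 2 - 1 :=
    (Nat.modEq_iff_dvd' (Nat.one_le_pow _ _ (Fact.out : p.Prime).pos)).mp
      (by simp [Nat.ModEq, Nat.pow_mod, hp3])
  have hindex : (cubeSubgroup p).index = 3 := by
    rw [cubeSubgroup, IsCyclic.index_powMonoidHom_range, hcard]
    exact Nat.gcd_eq_right hdvd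
  rw [← hcard, ← (cubeSubgroup p).card_mul_index, hindex]

/-- Every element of `𝔽_pˣ` is a cube when `p ≡ 2 (mod 3)`. -/
lemma map_mem_cubeSubgroup (p : ℕ) [Fact p.Prime] (hp3 : p % 3 = 2) (a : (ZMod p)ˣ) :
    Units.map (algebraMap (ZMod p) (GaloisField p 2) : ZMod p →* GaloisField p 2) a ∈
      cubeSubgroup p := by
  have hcop : (Nat.card (ZMod p)ˣ).Coprime 3 := by
    rw [Nat.card_eq_fintype_card, ZMod.card_units, Nat.coprime_comm,
      Nat.prime_three.coprime_iff_not_dvd]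
    omega
  obtain ⟨c, rfl⟩ := (powCoprime hcop).surjective a
  exact ⟨Units.map (algebraMap (ZMod p) (GaloisField p 2) : ZMod p →* GaloisField p 2) c,
    by simp⟩

/-- Let `p ≥ 5` be a prime with `p ≡ 2 (mod 3)`, `z` a quadratic
non-residue in `(ℤ/pℤ)ˣ` and `s ∈ 𝔽_{p²}` with `s² = z`. Then `1 + b·s ≠ 0` for all
`b ∈ 𝔽_p`; exactly `(p-2)/3` elements `b` have `1 + b·s` a cube in `𝔽_{p²}ˣ`, and for each
of the two nontrivial cosets `t` of the cubes, exactly `(p+1)/3` elements `b` satisfy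
`1 + b·s ∈ t`. -/
theorem statement16 (p : ℕ) (hp : p.Prime) [Fact p.Prime] (hp5 : 5 ≤ p) (hp3 : p % 3 = 2)
    (z : (ZMod p)ˣ) (hz : ¬IsSquare z) (s : GaloisField p 2)
    (hs : s ^ 2 = algebraMap (ZMod p) (GaloisField p 2) (z : ZMod p)) :
    (∀ b : ZMod p, 1 + algebraMap (ZMod p) (GaloisField p 2) b * s ≠ 0) ∧
    {b : ZMod p | memCoset p s b (QuotientGroup.mk 1)}.ncard = (p - 2) / 3 ∧
    (∀ t : CubeCosets p, t ≠ QuotientGroup.mk 1 →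
      {b : ZMod p | memCoset p s b t}.ncard = (p + 1) / 3) := by
  have hz' : ¬IsSquare (z : ZMod p) := by
    rintro ⟨w, hw⟩
    have hw0 : w ≠ 0 := by
      rintro rfl
      simp at hw
    exact hz ⟨Units.mk0 w hw0, Units.ext hw⟩
  have hne (b : ZMod p) : 1 + algebraMap (ZMod p) (GaloisField p 2) b * s ≠ 0 := fun h =>
    one_ne_zero (eq_zero_of_add_mul_sqrt_eq_zero hz' hs (x := 1) (y := b) (by simpa using h)).1
  have hs0 : s ≠ 0 := by
    rintro rfl
    rw [zero_pow two_ne_zero, eq_comm, map_eq_zero] at hs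
    exact z.ne_zero hs
  let S : (GaloisField p 2)ˣ := Units.mk0 s hs0
  have hS2 : S ^ 2 ∈ cubeSubgroup p := by
    have : S ^ 2 = Units.map
        (algebraMap (ZMod p) (GaloisField p 2) : ZMod p →* GaloisField p 2) z := Units.ext hs
    exact this ▸ map_mem_cubeSubgroup p hp3 z
  have hS : S ∈ cubeSubgroup p := by
    have h3 : S ^ 3 ∈ cubeSubgroup p := ⟨S, rfl⟩
    rw [pow_succ] at h3
    exact ((cubeSubgroup p).mul_mem_cancel_left hS2).mp h3
  have hbij := bijective_smul_lineRep
    (by rw [GaloisField.card p 2 two_ne_zero, Nat.card_zmod]) hz' S hs hne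
  have hcount (t : CubeCosets p) :
      {b : ZMod p | memCoset p s b t}.ncard + (if QuotientGroup.mk 1 = t then 1 else 0) =
        (p + 1) / 3 := by
    have hmem (b : ZMod p) : memCoset p s b t ↔
        (QuotientGroup.mk (lineRep S hne (some b)) : CubeCosets p) = t :=
      ⟨fun ⟨_, h⟩ => h, fun h => ⟨hne b, h⟩⟩
    have hnone : (QuotientGroup.mk (lineRep S hne none) : CubeCosets p) = QuotientGroup.mk 1 :=
      (QuotientGroup.eq_one_iff S).mpr hS
    have hopt := ncard_option_setOf fun o =>
      (QuotientGroup.mk (lineRep S hne o) : CubeCosets p) = t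
    simp only [hnone] at hopt
    simp only [hmem]
    rw [← hopt]
    have hmul := ncard_coset_mul_card (cubeSubgroup p) (Equiv.ofBijective _ hbij) (lineRep S hne)
      (fun o a => by
        rw [Equiv.ofBijective_apply, QuotientGroup.mk_mul,
          (QuotientGroup.eq_one_iff _).mpr (map_mem_cubeSubgroup p hp3 a), one_mul]) t
    have hH := card_cubeSubgroup p hp3
    rw [← hmul, Nat.card_eq_fintype_card, ZMod.card_units] at hH
    have hsq : p ^ 2 - 1 = (p + 1) * (p - 1) := by simpa using Nat.sq_sub_sq p 1
    rw [hsq, mul_right_comm] at hH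
    have := Nat.eq_of_mul_eq_mul_right (by omega) hH
    omega
  refine ⟨hne, ?_, fun t ht => ?_⟩
  · have := hcount (QuotientGroup.mk 1)
    rw [if_pos rfl] at this
    omega
  · have := hcount t
    rwa [if_neg ht.symm] at this

end
end

section
/- Let x be a nonzero element of ℚ₃. Then x is a cube in ℚ₃ (i.e. x = y³ for some y ∈ ℚ₃) if and only if there exist an integer k ∈ ℤ and a 3-adic integer u ∈ ℤ₃ with |u − 1|₃ ≤ 1/9 such that x = 27^k·u or x = −27^k·u. -/
namespace PadicInt

theorem norm_le_inv_nine_iff_toZModPow_eq_zero (a : ℤ_[3]) :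
    ‖a‖ ≤ (9 : ℝ)⁻¹ ↔ toZModPow 2 a = 0 := by
  rw [← RingHom.mem_ker, ker_toZModPow, ← norm_le_pow_iff_mem_span_pow]
  norm_num [zpow_neg]

theorem norm_le_inv_nine_iff_dvd (a : ℤ_[3]) : ‖a‖ ≤ (9 : ℝ)⁻¹ ↔ 9 ∣ a := by
  rw [norm_le_inv_nine_iff_toZModPow_eq_zero, ← RingHom.mem_ker, ker_toZModPow,
    Ideal.mem_span_singleton]
  norm_num

/-- The cube of a `3`-adic unit is congruent to `±1` modulo `9`. -/
theorem norm_units_pow_three_sub_one_le (v : ℤ_[3]ˣ) :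
    ‖(v : ℤ_[3]) ^ 3 - 1‖ ≤ (9 : ℝ)⁻¹ ∨ ‖-(v : ℤ_[3]) ^ 3 - 1‖ ≤ (9 : ℝ)⁻¹ := by
  have key : ∀ a b : ZMod (3 ^ 2), a * b = 1 → a ^ 3 - 1 = 0 ∨ -a ^ 3 - 1 = 0 := by decide
  have h : toZModPow 2 (v : ℤ_[3]) * toZModPow 2 ((v⁻¹ : ℤ_[3]ˣ) : ℤ_[3]) = 1 := by
    rw [← map_mul, Units.mul_inv, map_one]
  simpa [norm_le_inv_nine_iff_toZModPow_eq_zero] using key _ _ h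

/-- A `3`-adic integer congruent to `1` modulo `9` is a cube. -/
theorem exists_pow_three_eq_of_norm_sub_one_le {u : ℤ_[3]} (hu : ‖u - 1‖ ≤ (9 : ℝ)⁻¹) :
    ∃ z : ℤ_[3], z ^ 3 = u := by
  obtain ⟨c, hc⟩ := (norm_le_inv_nine_iff_dvd _).1 hu
  obtain rfl : u = 1 + 9 * c := by linear_combination hc
  have h3 : ‖(3 : ℤ_[3])‖ = 3⁻¹ := by simpa using norm_p (p := 3)
  have ha : ‖1 + 3 * c‖ = 1 := by
    have hlt : ‖3 * c‖ < ‖(1 : ℤ_[3])‖ := by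
      rw [norm_mul, h3, norm_one]
      linarith [norm_le_one c]
    rw [norm_add_eq_max_of_ne hlt.ne', max_eq_left hlt.le, norm_one]
  -- Newton's method starts at `1 + 3 * c`, as `1` itself is not close enough to a root.
  obtain ⟨z, hz, -⟩ := hensels_lemma (p := 3)
      (F := (Polynomial.X ^ 3 - Polynomial.C (1 + 9 * c) : Polynomial ℤ_[3]))
      (a := 1 + 3 * c) (by
    have hF : (1 + 3 * c) ^ 3 - (1 + 9 * c) = 3 ^ 3 * (c ^ 2 + c ^ 3) := by ring
    simp only [map_sub, map_pow, Polynomial.aeval_X, Polynomial.aeval_C, Algebra.algebraMap_self,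
      RingHom.id_apply, Polynomial.derivative_X_pow, Polynomial.derivative_C, sub_zero, hF, map_mul,
      norm_mul, norm_pow, h3, ha, Nat.cast_ofNat]
    norm_num [h3, ha]
    linarith [norm_le_one (c ^ 2 + c ^ 3)])
  exact ⟨z, by simpa [sub_eq_zero] using hz⟩

end PadicInt

/-- Every nonzero `p`-adic number is a power of `p` times a unit. -/
theorem Padic.exists_eq_zpow_mul_unit {p : ℕ} [Fact p.Prime] {y : ℚ_[p]} (hy : y ≠ 0) :
    ∃ (n : ℤ) (v : ℤ_[p]ˣ), y = (p : ℚ_[p]) ^ n * ((v : ℤ_[p]) : ℚ_[p]) := by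
  have hp : (p : ℚ_[p]) ≠ 0 := by exact_mod_cast (Fact.out : p.Prime).ne_zero
  have hp' : (p : ℝ) ≠ 0 := by exact_mod_cast (Fact.out : p.Prime).ne_zero
  have hv : ‖y * (p : ℚ_[p]) ^ (-y.valuation)‖ = 1 := by
    rw [norm_mul, Padic.norm_eq_zpow_neg_valuation hy, Padic.norm_p_zpow, ← zpow_add₀ hp']
    simp
  refine ⟨y.valuation, PadicInt.mkUnits hv, ?_⟩
  rw [PadicInt.mkUnits_eq, mul_left_comm, ← zpow_add₀ hp]
  simp

/-- A nonzero element `x` of `ℚ₃` is a cube if and only if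
`x = ±27^k·u` for some `k ∈ ℤ` and some `u ∈ ℤ₃` with `|u − 1|₃ ≤ 1/9`. -/
theorem statement19 (x : ℚ_[3]) (hx : x ≠ 0) :
    (∃ y : ℚ_[3], y ^ 3 = x) ↔
      ∃ (k : ℤ) (u : ℤ_[3]), ‖u - 1‖ ≤ (9 : ℝ)⁻¹ ∧
        (x = (27 : ℚ_[3]) ^ k * (u : ℚ_[3]) ∨ x = -((27 : ℚ_[3]) ^ k * (u : ℚ_[3]))) := by
  have h27 (k : ℤ) : (27 : ℚ_[3]) ^ k = ((3 : ℚ_[3]) ^ k) ^ 3 := by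
    rw [← zpow_natCast, zpow_comm, zpow_natCast]
    norm_num
  constructor
  · rintro ⟨y, rfl⟩
    obtain ⟨n, v, rfl⟩ := Padic.exists_eq_zpow_mul_unit (ne_zero_pow three_ne_zero hx)
    rcases PadicInt.norm_units_pow_three_sub_one_le v with h | h
    · refine ⟨n, _, h, Or.inl ?_⟩
      rw [h27]
      push_cast
      ring
    · refine ⟨n, _, h, Or.inr ?_⟩
      rw [h27]
      push_cast
      ring
  · rintro ⟨k, u, hu, h⟩
    obtain ⟨z, rfl⟩ := PadicInt.exists_pow_three_eq_of_norm_sub_one_le hu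
    rcases h with rfl | rfl
    · refine ⟨3 ^ k * z, ?_⟩
      rw [h27]
      push_cast
      ring
    · refine ⟨-(3 ^ k * z), ?_⟩
      rw [h27]
      push_cast
      ring
end
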